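/- Let f be a cusp form of even weight k for SL(2,ℤ) with Fourier coefficients a_f(n). Set κ = (k−1)/2 and, for real ν with 0 ≤ ν < κ + 1/6, set S_f^ν(n) = Σ_{m≤n} a_f(m)·m^{−ν}. Fix ε > 0 and define r(ν) = 2/3 + ε if ν < κ − 1/6, and r(ν) = 2/3 + Δ + ε if ν = κ − 1/6 + Δ with 0 ≤ Δ < 1/3. If Re(a_f(n)) ≠ 0 for at least one n, then there exists X0 > 0 such that for every X ≥ X0 there exist integers n, m with X < n, m ≤ X + X^{r(ν)}, Re(S_f^ν(n)) > 0 and Re(S_f^ν(m)) < 0. Likewise, if Im(a_f(n)) ≠ 0 for at least one n, then there exists X0 > 0 such that for every X ≥ X0 there exist integers n, m with X < n, m ≤ X + X^{r(ν)}, Im(S_f^ν(n)) > 0 and Im(S_f^ν(m)) < 0. -/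

import Mathlib

open Complex Filter Asymptotics

/-- The `(i, j)` entry of `γ ∈ SL(2, ℤ)`, viewed as a complex number. -/
def mEntry (γ : Matrix.SpecialLinearGroup (Fin 2) ℤ) (i j : Fin 2) : ℂ :=
  (((γ : Matrix (Fin 2) (Fin 2) ℤ) i j : ℤ) : ℂ)

/-- `f` is a cusp form of weight `k` for `SL(2, ℤ)` with Fourier coefficients
`a`: it is holomorphic on the upper half-plane, satisfies the weight-`k`
modular transformation law, and has Fourier expansion
`f z = ∑_{n ≥ 1} a n · e^{2πinz}`. -/
def IsCuspFormSL2 (k : ℤ) (f : ℂ → ℂ) (a : ℕ → ℂ) : Prop :=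
  DifferentiableOn ℂ f {z : ℂ | 0 < z.im} ∧
  (∀ γ : Matrix.SpecialLinearGroup (Fin 2) ℤ, ∀ z : ℂ, 0 < z.im →
    f ((mEntry γ 0 0 * z + mEntry γ 0 1) / (mEntry γ 1 0 * z + mEntry γ 1 1))
      = (mEntry γ 1 0 * z + mEntry γ 1 1) ^ k * f z) ∧
  (∀ z : ℂ, 0 < z.im →
    HasSum (fun n : ℕ => a (n + 1) * Complex.exp (2 * Real.pi * Complex.I * (n + 1) * z))
      (f z))


/-- The partial sums `S_f^ν(n) = ∑_{m ≤ n} a_f(m) · m^{−ν}` of the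
`ν`-normalized coefficients. -/
noncomputable def Spart (a : ℕ → ℂ) (ν : ℝ) (n : ℕ) : ℂ :=
  ∑ m ∈ Finset.Icc 1 n, a m * (((m : ℝ) ^ (-ν) : ℝ) : ℂ)

/-- The additive character `z ↦ e^{2πiz}`. -/
noncomputable def fourierExp (z : ℂ) : ℂ := cexp (2 * Real.pi * I * z)

lemma norm_fourierExp (z : ℂ) : ‖fourierExp z‖ = Real.exp (-(2 * Real.pi * z.im)) := by
  rw [fourierExp, Complex.norm_exp]
  congr 1
  simp

lemma fourierExp_add (z w : ℂ) : fourierExp (z + w) = fourierExp z * fourierExp w := by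
  rw [fourierExp, fourierExp, fourierExp, ← Complex.exp_add]
  congr 1
  ring

lemma continuous_fourierExp : Continuous fourierExp := by
  unfold fourierExp
  fun_prop

lemma differentiable_fourierExp : Differentiable ℂ fourierExp := by
  unfold fourierExp
  fun_prop

/-- A power series `f(z) = ∑ a(n) e(nz)` on the upper half-plane, without constant term and with
coefficients of polynomial growth, satisfying `f(-1/z) = z^{2j} f(z)`. -/
structure IsInversionSeries (j : ℕ) (f : ℂ → ℂ) (a : ℕ → ℂ) : Prop where
  coeff_zero : a 0 = 0
  coeff_bound : ∃ (A : ℕ) (C : ℝ), ∀ n, ‖a n‖ ≤ C * (n : ℝ) ^ A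
  hasSum : ∀ z : ℂ, 0 < z.im → HasSum (fun n : ℕ => a n * fourierExp (n * z)) (f z)
  inversion : ∀ z : ℂ, 0 < z.im → f (-1 / z) = z ^ (2 * j) * f z

lemma summable_pow_mul_exp_neg (B : ℕ) {y : ℝ} (hy : 0 < y) :
    Summable (fun n : ℕ => (n : ℝ) ^ B * Real.exp (-(y * n))) := by
  have := Real.summable_pow_mul_exp_neg_nat_mul B hy
  simpa [neg_mul] using this

lemma tsum_pow_mul_exp_neg_le (B : ℕ) :
    ∃ C : ℝ, 0 < C ∧ ∀ y : ℝ, 0 < y →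
      ∑' n : ℕ, (n : ℝ) ^ B * Real.exp (-(y * n)) ≤ C * (1 / y) ^ (B + 1) * Real.exp y := by
  refine ⟨(B.factorial : ℝ) * 2 ^ B * 3, by positivity, fun y hy => ?_⟩
  have hr1 : Real.exp (-(y / 2)) < 1 := by
    rw [← Real.exp_zero]
    exact Real.exp_lt_exp.mpr (by linarith)
  have hgeo := hasSum_geometric_of_lt_one (Real.exp_pos (-(y / 2))).le hr1
  have hterm : ∀ n : ℕ, (n : ℝ) ^ B * Real.exp (-(y * n)) ≤
      ((B.factorial : ℝ) * (2 / y) ^ B) * Real.exp (-(y / 2)) ^ n := by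
    intro n
    have h1 := Real.pow_div_factorial_le_exp (x := y / 2 * n) (by positivity) B
    rw [div_le_iff₀ (by positivity)] at h1
    have h2 : (n : ℝ) ^ B ≤ (B.factorial : ℝ) * (2 / y) ^ B * Real.exp (y / 2 * n) := by
      have : (n : ℝ) ^ B = (2 / y) ^ B * (y / 2 * n) ^ B := by
        rw [← mul_pow]; congr 1; field_simp
      rw [this]
      calc (2 / y) ^ B * (y / 2 * n) ^ B ≤ (2 / y) ^ B * (Real.exp (y / 2 * n) * B.factorial) := by
            gcongr
        _ = _ := by ring
    calc (n : ℝ) ^ B * Real.exp (-(y * n))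
        ≤ (B.factorial : ℝ) * (2 / y) ^ B * Real.exp (y / 2 * n) * Real.exp (-(y * n)) := by
          gcongr
      _ = _ := by
          rw [mul_assoc, ← Real.exp_add, ← Real.exp_nat_mul]
          congr 2
          ring
  have hsum := (summable_pow_mul_exp_neg B hy).tsum_le_tsum hterm
    (hgeo.summable.mul_left _)
  rw [tsum_mul_left, hgeo.tsum_eq] at hsum
  refine hsum.trans ?_
  have h3 : (1 - Real.exp (-(y / 2)))⁻¹ ≤ 3 / y * Real.exp y := by
    have h4 : Real.exp (-(y / 2)) ≤ 1 / (1 + y / 2) := by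
      rw [Real.exp_neg, ← one_div]
      gcongr
      linarith [Real.add_one_le_exp (y / 2)]
    have h5 : y / (2 + y) ≤ 1 - Real.exp (-(y / 2)) := by
      have : 1 - 1 / (1 + y / 2) = y / (2 + y) := by field_simp; ring
      linarith
    calc (1 - Real.exp (-(y / 2)))⁻¹ ≤ (y / (2 + y))⁻¹ := by gcongr
      _ = (2 + y) / y := inv_div _ _
      _ ≤ 3 / y * Real.exp y := by
          rw [div_mul_eq_mul_div]
          gcongr
          linarith [Real.add_one_le_exp y]
  calc (B.factorial : ℝ) * (2 / y) ^ B * (1 - Real.exp (-(y / 2)))⁻¹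
      ≤ (B.factorial : ℝ) * (2 / y) ^ B * (3 / y * Real.exp y) := by gcongr
    _ = _ := by
      rw [pow_succ, div_pow, div_pow, one_pow]
      ring

/-- Exponential sums with polynomially bounded coefficients and no constant term. -/
lemma norm_coeff_mul_fourierExp (c : ℂ) (n : ℕ) (z : ℂ) :
    ‖c * fourierExp (n * z)‖ = ‖c‖ * Real.exp (-(2 * Real.pi * (n * z.im))) := by
  rw [norm_mul, norm_fourierExp]
  simp

lemma summable_norm_coeff_mul_exp {a : ℕ → ℂ} {A : ℕ} {C : ℝ}
    (ha : ∀ n, ‖a n‖ ≤ C * (n : ℝ) ^ A) {y : ℝ} (hy : 0 < y) :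
    Summable (fun n : ℕ => ‖a n‖ * Real.exp (-(y * n))) := by
  refine Summable.of_nonneg_of_le (fun n => by positivity) (fun n => ?_)
    ((summable_pow_mul_exp_neg A hy).mul_left C)
  rw [← mul_assoc]
  exact mul_le_mul_of_nonneg_right (ha n) (Real.exp_pos _).le

lemma exists_tsum_norm_coeff_le {a : ℕ → ℂ} (h0 : a 0 = 0) {A : ℕ} {C : ℝ}
    (ha : ∀ n, ‖a n‖ ≤ C * (n : ℝ) ^ A) :
    ∃ C' : ℝ, 0 < C' ∧ ∀ y : ℝ, 0 < y →
      ∑' n : ℕ, ‖a n‖ * Real.exp (-(2 * Real.pi * (n * y))) ≤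
        C' * (1 / y) ^ (A + 1) * Real.exp (-y) := by
  obtain ⟨D, hD, hsum⟩ := tsum_pow_mul_exp_neg_le A
  have hC : 0 ≤ C := by
    have := (norm_nonneg _).trans (ha 1)
    simpa using this
  refine ⟨(C + 1) * D, by positivity, fun y hy => ?_⟩
  have hterm : ∀ n : ℕ, ‖a n‖ * Real.exp (-(2 * Real.pi * (n * y))) ≤
      (C + 1) * Real.exp (-(2 * y)) * ((n : ℝ) ^ A * Real.exp (-(y * n))) := by
    intro n
    rcases Nat.eq_zero_or_pos n with rfl | hn
    · simp only [h0, norm_zero, zero_mul]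
      positivity
    · have hn1 : (1 : ℝ) ≤ n := by exact_mod_cast hn
      have h1 : Real.exp (-(2 * Real.pi * (n * y))) ≤
          Real.exp (-(2 * y)) * Real.exp (-(y * n)) := by
        rw [← Real.exp_add]
        apply Real.exp_le_exp.mpr
        nlinarith [Real.pi_gt_three, mul_le_mul_of_nonneg_right hn1 hy.le,
          mul_nonneg (mul_nonneg (sub_nonneg.mpr Real.pi_gt_three.le) (by positivity : (0:ℝ) ≤ n)) hy.le]
      calc ‖a n‖ * Real.exp (-(2 * Real.pi * (n * y)))
          ≤ ((C + 1) * (n : ℝ) ^ A) * (Real.exp (-(2 * y)) * Real.exp (-(y * n))) := by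
            gcongr
            refine (ha n).trans ?_
            gcongr
            linarith
        _ = _ := by ring
  have hs : Summable fun n : ℕ => ‖a n‖ * Real.exp (-(2 * Real.pi * (n * y))) := by
    have := summable_norm_coeff_mul_exp ha (y := 2 * Real.pi * y) (by positivity)
    refine this.congr fun n => ?_
    congr 3
    ring
  refine (hs.tsum_le_tsum hterm ((summable_pow_mul_exp_neg A hy).mul_left _)).trans ?_
  rw [tsum_mul_left]
  calc (C + 1) * Real.exp (-(2 * y)) * ∑' n : ℕ, (n : ℝ) ^ A * Real.exp (-(y * n))
      ≤ (C + 1) * Real.exp (-(2 * y)) * (D * (1 / y) ^ (A + 1) * Real.exp y) := by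
        gcongr
        exact hsum y hy
    _ = (C + 1) * D * (1 / y) ^ (A + 1) * (Real.exp (-(2 * y)) * Real.exp y) := by ring
    _ = _ := by
      rw [← Real.exp_add]
      congr 2
      ring

lemma summable_norm_coeff_mul_fourierExp {a : ℕ → ℂ} {A : ℕ} {C : ℝ}
    (ha : ∀ n, ‖a n‖ ≤ C * (n : ℝ) ^ A) {z : ℂ} (hz : 0 < z.im) :
    Summable (fun n : ℕ => ‖a n * fourierExp (n * z)‖) := by
  have := summable_norm_coeff_mul_exp ha (y := 2 * Real.pi * z.im) (by positivity)
  refine this.congr fun n => ?_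
  rw [norm_coeff_mul_fourierExp]
  congr 3
  ring

lemma norm_tsum_coeff_mul_fourierExp_le {a : ℕ → ℂ} {A : ℕ} {C : ℝ}
    (ha : ∀ n, ‖a n‖ ≤ C * (n : ℝ) ^ A) {z : ℂ} (hz : 0 < z.im) :
    ‖∑' n : ℕ, a n * fourierExp (n * z)‖ ≤
      ∑' n : ℕ, ‖a n‖ * Real.exp (-(2 * Real.pi * (n * z.im))) := by
  refine (norm_tsum_le_tsum_norm (summable_norm_coeff_mul_fourierExp ha hz)).trans_eq ?_
  exact tsum_congr fun n => norm_coeff_mul_fourierExp _ _ _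

namespace IsInversionSeries

variable {j : ℕ} {f : ℂ → ℂ} {a : ℕ → ℂ}

lemma exists_norm_le (h : IsInversionSeries j f a) :
    ∃ (B : ℕ) (C : ℝ), 0 < C ∧ ∀ z : ℂ, 0 < z.im →
      ‖f z‖ ≤ C * (1 / z.im) ^ B * Real.exp (-z.im) := by
  obtain ⟨A, C, ha⟩ := h.coeff_bound
  obtain ⟨C', hC', hle⟩ := exists_tsum_norm_coeff_le h.coeff_zero ha
  refine ⟨A + 1, C', hC', fun z hz => ?_⟩
  rw [← (h.hasSum z hz).tsum_eq]
  exact (norm_tsum_coeff_mul_fourierExp_le ha hz).trans (hle _ hz)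

lemma exists_norm_le_pow (h : IsInversionSeries j f a) :
    ∃ B : ℕ, ∀ N : ℕ, B ≤ N → ∃ C : ℝ, 0 < C ∧ ∀ z : ℂ, 0 < z.im →
      ‖f z‖ ≤ C * (1 / z.im) ^ N := by
  obtain ⟨B, C, hC, hle⟩ := h.exists_norm_le
  refine ⟨B, fun N hN => ⟨C * (N - B).factorial, by positivity, fun z hz => ?_⟩⟩
  refine (hle z hz).trans ?_
  have h1 := Real.pow_div_factorial_le_exp (x := z.im) hz.le (N - B)
  rw [div_le_iff₀ (by positivity)] at h1
  have h2 : (1 / z.im) ^ B = (1 / z.im) ^ N * z.im ^ (N - B) := by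
    conv_rhs => rw [← Nat.sub_add_cancel hN, pow_add]
    rw [Nat.add_sub_cancel, mul_right_comm, ← mul_pow, one_div_mul_cancel hz.ne', one_pow, one_mul]
  rw [h2]
  calc C * ((1 / z.im) ^ N * z.im ^ (N - B)) * Real.exp (-z.im)
      ≤ C * ((1 / z.im) ^ N * (Real.exp z.im * (N - B).factorial)) * Real.exp (-z.im) := by
        gcongr
    _ = C * (N - B).factorial * (1 / z.im) ^ N * (Real.exp z.im * Real.exp (-z.im)) := by ring
    _ = _ := by rw [← Real.exp_add]; simp

lemma im_neg_one_div (z : ℂ) : (-1 / z).im = z.im / normSq z := by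
  rw [neg_div, neg_im, one_div, inv_im]
  ring

/-- Near the cusp `0`, in a region thinner than a horocycle, `f` is bounded. -/
lemma exists_norm_le_of_abs_re_le (h : IsInversionSeries j f a) {δ : ℝ} (hδ : 0 < δ)
    (hδ' : δ ≤ 1 / 2) :
    ∃ C : ℝ, 0 < C ∧ ∀ z : ℂ, 0 < z.im → |z.re| ≤ z.im ^ (1 / 2 + δ) →
      ‖f z‖ ≤ C * Real.exp (-z.im) := by
  obtain ⟨B₀, C₀, hC₀, h₀⟩ := h.exists_norm_le
  obtain ⟨B, hB⟩ := h.exists_norm_le_pow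
  obtain ⟨M, hM⟩ := exists_nat_ge ((j : ℝ) / (2 * δ))
  obtain ⟨C, hC, hN⟩ := hB (j + (M + B)) (by omega)
  refine ⟨C₀ + C * 2 ^ (M + B) * Real.exp 1, by positivity, fun z hz hre => ?_⟩
  rcases le_total 1 z.im with h1 | h1
  · refine (h₀ z hz).trans ?_
    have : (1 / z.im) ^ B₀ ≤ 1 := pow_le_one₀ (by positivity) (by rw [div_le_one hz]; exact h1)
    gcongr
    calc C₀ * (1 / z.im) ^ B₀ ≤ C₀ * 1 := by gcongr
      _ ≤ _ := by rw [mul_one]; exact le_add_of_nonneg_right (by positivity)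
  · have hz0 : z ≠ 0 := by rintro rfl; simp at hz
    have hns : 0 < normSq z := normSq_pos.mpr hz0
    have him : 0 < (-1 / z).im := by rw [im_neg_one_div]; positivity
    have h2 := hN (-1 / z) him
    rw [h.inversion z hz, norm_mul, norm_pow, pow_mul, ← normSq_eq_norm_sq, im_neg_one_div,
      one_div_div, pow_add, div_pow, div_pow, mul_comm] at h2
    have h3 : ‖f z‖ ≤ C * (normSq z ^ (M + B) / z.im ^ (j + (M + B))) := by
      have h4 : C * (normSq z ^ j / z.im ^ j * (normSq z ^ (M + B) / z.im ^ (M + B))) =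
          (C * (normSq z ^ (M + B) / z.im ^ (j + (M + B)))) * normSq z ^ j := by
        field_simp
        ring
      rw [h4] at h2
      exact le_of_mul_le_mul_right h2 (by positivity)
    have h5 : normSq z ≤ 2 * z.im ^ (1 + 2 * δ) := by
      rw [normSq_apply]
      have h6 : z.re * z.re ≤ z.im ^ (1 + 2 * δ) := by
        have : z.re * z.re = |z.re| * |z.re| := (abs_mul_abs_self _).symm
        rw [this]
        calc |z.re| * |z.re| ≤ z.im ^ (1 / 2 + δ) * z.im ^ (1 / 2 + δ) := by gcongr
          _ = _ := by rw [← Real.rpow_add hz]; congr 1; ring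
      have h7 : z.im * z.im ≤ z.im ^ (1 + 2 * δ) := by
        calc z.im * z.im = z.im ^ (2 : ℝ) := by rw [Real.rpow_two]; ring
          _ ≤ _ := Real.rpow_le_rpow_of_exponent_ge hz h1 (by linarith)
      linarith
    have h8 : normSq z ^ (M + B) / z.im ^ (j + (M + B)) ≤ 2 ^ (M + B) := by
      rw [div_le_iff₀ (by positivity)]
      calc normSq z ^ (M + B) ≤ (2 * z.im ^ (1 + 2 * δ)) ^ (M + B) := by gcongr
        _ = 2 ^ (M + B) * z.im ^ ((1 + 2 * δ) * ((M + B : ℕ) : ℝ)) := by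
          rw [mul_pow, Real.rpow_mul hz.le, Real.rpow_natCast]
        _ ≤ 2 ^ (M + B) * z.im ^ (((j + (M + B) : ℕ) : ℝ)) := by
          gcongr 2 ^ (M + B) * ?_
          apply Real.rpow_le_rpow_of_exponent_ge hz h1
          rw [div_le_iff₀ (by positivity)] at hM
          push_cast
          nlinarith [(Nat.cast_nonneg B : (0 : ℝ) ≤ B)]
        _ = _ := by rw [Real.rpow_natCast]
    calc ‖f z‖ ≤ C * 2 ^ (M + B) := h3.trans (by gcongr)
      _ ≤ C * 2 ^ (M + B) * (Real.exp 1 * Real.exp (-z.im)) := by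
        apply le_mul_of_one_le_right (by positivity)
        rw [← Real.exp_add]
        exact Real.one_le_exp (by linarith)
      _ ≤ _ := by
        rw [← mul_assoc]
        gcongr
        exact le_add_of_nonneg_left hC₀.le

end IsInversionSeries

/-- The twisted series `∑ a(n) n^{-ν} e(nz)`. -/
noncomputable def twistedSeries (a : ℕ → ℂ) (ν : ℝ) (z : ℂ) : ℂ :=
  ∑' n : ℕ, a n * (((n : ℝ) ^ (-ν) : ℝ) : ℂ) * fourierExp (n * z)

lemma integrableOn_rpow_mul_exp_neg_mul {ν r : ℝ} (hν : 0 < ν) (hr : 0 < r) :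
    MeasureTheory.IntegrableOn (fun t : ℝ => t ^ (ν - 1) * Real.exp (-(r * t))) (Set.Ioi 0) := by
  have := integrableOn_rpow_mul_exp_neg_mul_rpow (p := 1) (s := ν - 1) (b := r) (by linarith)
    one_pos hr
  simpa [neg_mul] using this

lemma norm_coeff_mul_rpow_neg_le {a : ℕ → ℂ} (h0 : a 0 = 0) {ν : ℝ} (hν : 0 ≤ ν) (n : ℕ) :
    ‖a n * (((n : ℝ) ^ (-ν) : ℝ) : ℂ)‖ ≤ ‖a n‖ := by
  rcases Nat.eq_zero_or_pos n with rfl | hn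
  · simp [h0]
  · rw [norm_mul, Complex.norm_real, Real.norm_of_nonneg (by positivity)]
    refine mul_le_of_le_one_right (norm_nonneg _) ?_
    exact Real.rpow_le_one_of_one_le_of_nonpos (by exact_mod_cast hn) (by linarith)

namespace IsInversionSeries

variable {j : ℕ} {f : ℂ → ℂ} {a : ℕ → ℂ}

lemma Gamma_mul_twistedSeries (h : IsInversionSeries j f a) {ν : ℝ} (hν : 0 < ν) {z : ℂ}
    (hz : 0 < z.im) :
    (Real.Gamma ν : ℂ) * twistedSeries a ν z =
      ∫ t in Set.Ioi (0 : ℝ), ((t ^ (ν - 1) : ℝ) : ℂ) * f (z + (t / (2 * Real.pi) : ℝ) * I) := by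
  obtain ⟨A, C, ha⟩ := h.coeff_bound
  set F : ℕ → ℝ → ℂ := fun n t =>
    a n * fourierExp (n * z) * ((t ^ (ν - 1) * Real.exp (-(n * t)) : ℝ) : ℂ) with hF
  have hintegrable : ∀ n : ℕ, 1 ≤ n → MeasureTheory.IntegrableOn
      (fun t : ℝ => t ^ (ν - 1) * Real.exp (-((n : ℝ) * t))) (Set.Ioi 0) := fun n hn =>
    integrableOn_rpow_mul_exp_neg_mul hν (by exact_mod_cast hn)
  have hFint : ∀ n, MeasureTheory.Integrable (F n)
      (MeasureTheory.volume.restrict (Set.Ioi (0 : ℝ))) := by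
    intro n
    rcases Nat.eq_zero_or_pos n with rfl | hn
    · simp [hF, h.coeff_zero]
    · exact ((hintegrable n hn).ofReal (𝕜 := ℂ)).const_mul _
  have hval : ∀ n : ℕ, 1 ≤ n → ∫ t in Set.Ioi (0 : ℝ), t ^ (ν - 1) * Real.exp (-((n : ℝ) * t)) =
      (n : ℝ) ^ (-ν) * Real.Gamma ν := by
    intro n hn
    rw [Real.integral_rpow_mul_exp_neg_mul_Ioi hν (by exact_mod_cast hn), one_div,
      Real.inv_rpow (by positivity), ← Real.rpow_neg (by positivity)]
  have hFval : ∀ n, ∫ t in Set.Ioi (0 : ℝ), F n t =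
      (Real.Gamma ν : ℂ) * (a n * (((n : ℝ) ^ (-ν) : ℝ) : ℂ) * fourierExp (n * z)) := by
    intro n
    rcases Nat.eq_zero_or_pos n with rfl | hn
    · simp [hF, h.coeff_zero]
    · simp only [hF]
      rw [MeasureTheory.integral_const_mul, integral_complex_ofReal, hval n hn]
      push_cast
      ring
  have hGnn : 0 ≤ Real.Gamma ν := (Real.Gamma_pos_of_pos hν).le
  have hnorm : ∀ n, ∫ t in Set.Ioi (0 : ℝ), ‖F n t‖ ≤ Real.Gamma ν * ‖a n * fourierExp (n * z)‖ := by
    intro n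
    rcases Nat.eq_zero_or_pos n with rfl | hn
    · simp [hF, h.coeff_zero]
    · have : ∫ t in Set.Ioi (0 : ℝ), ‖F n t‖ = ∫ t in Set.Ioi (0 : ℝ),
          ‖a n * fourierExp (n * z)‖ * (t ^ (ν - 1) * Real.exp (-((n : ℝ) * t))) := by
        refine MeasureTheory.setIntegral_congr_fun measurableSet_Ioi fun t ht => ?_
        have ht' : (0 : ℝ) < t := ht
        simp only [hF]
        rw [norm_mul, Complex.norm_real, Real.norm_of_nonneg (by positivity)]
      rw [this, MeasureTheory.integral_const_mul, hval n hn, mul_comm]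
      refine mul_le_mul_of_nonneg_right ?_ (norm_nonneg _)
      refine mul_le_of_le_one_left hGnn ?_
      exact Real.rpow_le_one_of_one_le_of_nonpos (by exact_mod_cast hn) (by linarith)
  have hsum := MeasureTheory.hasSum_integral_of_summable_integral_norm hFint
    (Summable.of_nonneg_of_le (fun n => MeasureTheory.integral_nonneg fun t => norm_nonneg _) hnorm
      ((summable_norm_coeff_mul_fourierExp ha hz).mul_left _))
  simp_rw [hFval] at hsum
  rw [twistedSeries, ← tsum_mul_left, hsum.tsum_eq]
  refine MeasureTheory.setIntegral_congr_fun measurableSet_Ioi fun t ht => ?_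
  have ht' : (0 : ℝ) < t := ht
  have him : 0 < (z + (t / (2 * Real.pi) : ℝ) * I).im := by
    have : 0 < t / (2 * Real.pi) := by positivity
    simp only [add_im, mul_im, ofReal_re, I_im, ofReal_im, I_re]
    linarith
  rw [← (h.hasSum _ him).tsum_eq, ← tsum_mul_left]
  refine tsum_congr fun n => ?_
  simp only [hF]
  rw [mul_add, fourierExp_add]
  have : fourierExp (n * ((t / (2 * Real.pi) : ℝ) * I)) = ((Real.exp (-(n * t)) : ℝ) : ℂ) := by
    rw [fourierExp]
    push_cast
    congr 1
    have hpi : (Real.pi : ℂ) ≠ 0 := by exact_mod_cast Real.pi_ne_zero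
    field_simp
    rw [I_sq]
    ring
  rw [this]
  push_cast
  ring

lemma exists_norm_twistedSeries_le_of_abs_re_le (h : IsInversionSeries j f a) {ν : ℝ} (hν : 0 ≤ ν)
    {δ : ℝ} (hδ : 0 < δ) (hδ' : δ ≤ 1 / 2) :
    ∃ C : ℝ, 0 < C ∧ ∀ z : ℂ, 0 < z.im → |z.re| ≤ z.im ^ (1 / 2 + δ) →
      ‖twistedSeries a ν z‖ ≤ C := by
  obtain ⟨C, hC, hle⟩ := h.exists_norm_le_of_abs_re_le hδ hδ'
  rcases hν.eq_or_lt with rfl | hν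
  · refine ⟨C, hC, fun z hz hre => ?_⟩
    have : twistedSeries a 0 z = f z := by
      rw [twistedSeries, ← (h.hasSum z hz).tsum_eq]
      simp
    rw [this]
    refine (hle z hz hre).trans (mul_le_of_le_one_right hC.le ?_)
    exact Real.exp_le_one_iff.mpr (by linarith)
  · set D := ∫ t in Set.Ioi (0 : ℝ), C * (t ^ (ν - 1) * Real.exp (-(1 / (2 * Real.pi) * t))) with hD
    have hG : 0 < Real.Gamma ν := Real.Gamma_pos_of_pos hν
    have hDnn : 0 ≤ D := by
      refine MeasureTheory.setIntegral_nonneg measurableSet_Ioi fun t ht => ?_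
      have ht' : (0 : ℝ) < t := ht
      positivity
    refine ⟨(D + 1) / Real.Gamma ν, by positivity, fun z hz hre => ?_⟩
    rw [le_div_iff₀ hG]
    have h1 : ‖twistedSeries a ν z‖ * Real.Gamma ν =
        ‖(Real.Gamma ν : ℂ) * twistedSeries a ν z‖ := by
      rw [norm_mul, Complex.norm_real, Real.norm_of_nonneg hG.le, mul_comm]
    rw [h1, h.Gamma_mul_twistedSeries hν hz]
    refine le_trans ?_ (by linarith : D ≤ D + 1)
    refine MeasureTheory.norm_integral_le_of_norm_le
      ((integrableOn_rpow_mul_exp_neg_mul hν (by positivity)).const_mul C) ?_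
    refine (MeasureTheory.ae_restrict_mem measurableSet_Ioi).mono fun t ht => ?_
    have ht' : (0 : ℝ) < t := ht
    have him' : (z + (t / (2 * Real.pi) : ℝ) * I).im = z.im + t / (2 * Real.pi) := by
      simp only [add_im, mul_im, ofReal_re, I_im, ofReal_im, I_re]
      ring
    have hre' : (z + (t / (2 * Real.pi) : ℝ) * I).re = z.re := by
      simp only [add_re, mul_re, ofReal_re, I_im, ofReal_im, I_re]
      ring
    have hpos : 0 < t / (2 * Real.pi) := by positivity
    have h2 := hle (z + (t / (2 * Real.pi) : ℝ) * I) (by rw [him']; linarith) (by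
      rw [him', hre']
      exact hre.trans (Real.rpow_le_rpow hz.le (by linarith) (by linarith)))
    rw [norm_mul, Complex.norm_real, Real.norm_of_nonneg (by positivity)]
    calc t ^ (ν - 1) * ‖f (z + (t / (2 * Real.pi) : ℝ) * I)‖
        ≤ t ^ (ν - 1) * (C * Real.exp (-(1 / (2 * Real.pi) * t))) := by
          gcongr
          refine h2.trans ?_
          gcongr
          rw [him', one_div_mul_eq_div]
          linarith
      _ = _ := by ring

end IsInversionSeries

lemma Spart_eq_sum_range {a : ℕ → ℂ} (h0 : a 0 = 0) (ν : ℝ) (n : ℕ) :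
    Spart a ν n = ∑ m ∈ Finset.range (n + 1), a m * (((m : ℝ) ^ (-ν) : ℝ) : ℂ) := by
  rw [Spart, Finset.sum_range_eq_add_Ico _ (Nat.succ_pos n), h0, zero_mul, zero_add]
  rfl

lemma exists_norm_Spart_le {a : ℕ → ℂ} (h0 : a 0 = 0) {A : ℕ} {C : ℝ}
    (ha : ∀ n, ‖a n‖ ≤ C * (n : ℝ) ^ A) {ν : ℝ} (hν : 0 ≤ ν) (n : ℕ) :
    ‖Spart a ν n‖ ≤ C * (n : ℝ) ^ (A + 1) := by
  have hC : 0 ≤ C := by simpa using (norm_nonneg _).trans (ha 1)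
  calc ‖Spart a ν n‖ ≤ ∑ m ∈ Finset.Icc 1 n, C * (n : ℝ) ^ A := by
        refine norm_sum_le_of_le _ fun m hm => ?_
        refine ((norm_coeff_mul_rpow_neg_le h0 hν m).trans (ha m)).trans ?_
        have : (m : ℝ) ≤ n := by exact_mod_cast (Finset.mem_Icc.mp hm).2
        gcongr
    _ = C * (n : ℝ) ^ (A + 1) := by
        rw [Finset.sum_const, Nat.card_Icc, nsmul_eq_mul, Nat.add_sub_cancel]
        ring

lemma fourierExp_natCast_mul (n : ℕ) (z : ℂ) : fourierExp (n * z) = fourierExp z ^ n := by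
  rw [fourierExp, fourierExp, ← Complex.exp_nat_mul]
  congr 1
  ring

lemma norm_fourierExp_lt_one {z : ℂ} (hz : 0 < z.im) : ‖fourierExp z‖ < 1 := by
  rw [norm_fourierExp, Real.exp_lt_one_iff]
  have := Real.pi_pos
  nlinarith [mul_pos this hz]

/-- The generating series of the partial sums. -/
lemma hasSum_Spart_mul_fourierExp {a : ℕ → ℂ} (h0 : a 0 = 0) {A : ℕ} {C : ℝ}
    (ha : ∀ n, ‖a n‖ ≤ C * (n : ℝ) ^ A) {ν : ℝ} (hν : 0 ≤ ν) {z : ℂ} (hz : 0 < z.im) :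
    HasSum (fun n : ℕ => Spart a ν n * fourierExp (n * z))
      (twistedSeries a ν z / (1 - fourierExp z)) := by
  have hq := norm_fourierExp_lt_one hz
  have hf : Summable fun n : ℕ => ‖a n * (((n : ℝ) ^ (-ν) : ℝ) : ℂ) * fourierExp (n * z)‖ :=
    summable_norm_coeff_mul_fourierExp (fun n => (norm_coeff_mul_rpow_neg_le h0 hν n).trans (ha n))
      hz
  have hg : Summable fun n : ℕ => ‖fourierExp z ^ n‖ := by
    simpa only [norm_pow] using summable_geometric_of_lt_one (norm_nonneg _) hq
  have := hasSum_sum_range_mul_of_summable_norm hf hg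
  rw [tsum_geometric_of_norm_lt_one hq, ← twistedSeries, ← div_eq_mul_inv] at this
  refine Eq.mpr (congrArg (fun g => HasSum g _) (funext fun n => ?_)) this
  rw [Spart_eq_sum_range h0, Finset.sum_mul]
  refine Finset.sum_congr rfl fun m hm => ?_
  have hm' : m ≤ n := Nat.lt_succ_iff.mp (Finset.mem_range.mp hm)
  rw [fourierExp_natCast_mul, fourierExp_natCast_mul, mul_assoc (_ * _), ← pow_add,
    Nat.add_sub_cancel' hm']

lemma integrable_gaussian_line {h : ℝ} (hh : 0 < h) (y : ℝ) :
    MeasureTheory.Integrable fun u : ℝ => Real.exp (-(Real.pi * h ^ 2 * (u ^ 2 - y ^ 2))) := by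
  have := (integrable_exp_neg_mul_sq (b := Real.pi * h ^ 2) (by positivity)).mul_const
    (Real.exp (Real.pi * h ^ 2 * y ^ 2))
  refine this.congr (Filter.Eventually.of_forall fun u => ?_)
  simp only
  rw [← Real.exp_add]
  congr 1
  ring

lemma norm_gaussian (h u y : ℝ) :
    ‖cexp (-(Real.pi * h ^ 2 * (u + y * I) ^ 2))‖ =
      Real.exp (-(Real.pi * h ^ 2 * (u ^ 2 - y ^ 2))) := by
  rw [Complex.norm_exp]
  congr 1
  have : (-(Real.pi * h ^ 2 * (u + y * I) ^ 2) : ℂ) =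
      ((-(Real.pi * h ^ 2 * (u ^ 2 - y ^ 2)) : ℝ) : ℂ) +
        ((-(2 * Real.pi * h ^ 2 * u * y) : ℝ) : ℂ) * I := by
    push_cast
    ring_nf
    rw [I_sq]
    ring
  rw [this, add_re, ofReal_re, re_ofReal_mul, I_re, mul_zero, add_zero]

lemma integral_gaussian_mul_fourierExp {h : ℝ} (hh : 0 < h) (y N : ℝ) :
    ∫ u : ℝ, cexp (-(Real.pi * h ^ 2 * (u + y * I) ^ 2)) * fourierExp (N * (u + y * I)) =
      ((1 / h * Real.exp (-(Real.pi * (N / h) ^ 2)) : ℝ) : ℂ) := by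
  have hb : (-(Real.pi * h ^ 2 : ℝ) : ℂ).re < 0 := by
    rw [neg_re, ofReal_re, neg_lt_zero]
    positivity
  have key := integral_cexp_quadratic hb (2 * Real.pi * I * (N - h ^ 2 * y))
    (Real.pi * h ^ 2 * y ^ 2 - 2 * Real.pi * N * y)
  have hh' : (h : ℂ) ≠ 0 := by exact_mod_cast hh.ne'
  have hpi : (Real.pi : ℂ) ≠ 0 := by exact_mod_cast Real.pi_ne_zero
  refine Eq.trans (MeasureTheory.integral_congr_ae (Eventually.of_forall fun u => ?_)) (key.trans ?_)
  · simp only [fourierExp]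
    rw [← Complex.exp_add]
    congr 1
    push_cast
    ring_nf
    rw [I_sq]
    ring
  · have h1 : (Real.pi / -(-(Real.pi * h ^ 2 : ℝ) : ℂ)) = (((1 / h) ^ 2 : ℝ) : ℂ) := by
      push_cast
      field_simp
    rw [h1, ofReal_mul (1 / h)]
    congr 1
    · have : (1 / 2 : ℂ) = ((1 / 2 : ℝ) : ℂ) := by push_cast; rfl
      rw [this, ← ofReal_cpow (by positivity), ← Real.sqrt_eq_rpow, Real.sqrt_sq (by positivity)]
    · rw [ofReal_exp]
      congr 1
      push_cast
      field_simp
      rw [I_sq]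
      ring

lemma hasSum_Spart_mul_gaussian {a : ℕ → ℂ} (h0 : a 0 = 0) {A : ℕ} {C : ℝ}
    (ha : ∀ n, ‖a n‖ ≤ C * (n : ℝ) ^ A) {ν : ℝ} (hν : 0 ≤ ν) {h : ℝ} (hh : 0 < h) {y : ℝ}
    (hy : 0 < y) (c : ℝ) :
    HasSum (fun n : ℕ => Spart a ν n * ((1 / h * Real.exp (-(Real.pi * ((n - c) / h) ^ 2)) : ℝ) : ℂ))
      (∫ u : ℝ, cexp (-(Real.pi * h ^ 2 * (u + y * I) ^ 2)) * fourierExp (-c * (u + y * I)) *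
        (twistedSeries a ν (u + y * I) / (1 - fourierExp (u + y * I)))) := by
  set F : ℕ → ℝ → ℂ := fun n u => Spart a ν n *
    (cexp (-(Real.pi * h ^ 2 * (u + y * I) ^ 2)) * fourierExp (((n - c : ℝ) : ℂ) * (u + y * I)))
    with hF
  have him : ∀ u : ℝ, ((u : ℂ) + y * I).im = y := fun u => by simp
  have hnorm : ∀ n u, ‖F n u‖ = ‖Spart a ν n‖ * Real.exp (-(2 * Real.pi * ((n - c) * y))) *
      Real.exp (-(Real.pi * h ^ 2 * (u ^ 2 - y ^ 2))) := by
    intro n u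
    simp only [hF]
    rw [norm_mul, norm_mul, norm_gaussian, norm_fourierExp]
    have : (((n - c : ℝ) : ℂ) * (u + y * I)).im = (n - c) * y := by
      rw [im_ofReal_mul, him]
    rw [this]
    ring
  have hFint : ∀ n, MeasureTheory.Integrable (F n) := by
    intro n
    have := (integrable_gaussian_line hh y).const_mul
      (‖Spart a ν n‖ * Real.exp (-(2 * Real.pi * ((n - c) * y))))
    refine this.mono' ?_ (Eventually.of_forall fun u => (hnorm n u).le)
    refine Continuous.aestronglyMeasurable ?_
    have := continuous_fourierExp
    simp only [hF]
    fun_prop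
  have hs : Summable fun n => ∫ u, ‖F n u‖ := by
    simp_rw [hnorm, MeasureTheory.integral_const_mul]
    refine Summable.mul_right _ ?_
    have := (summable_norm_coeff_mul_exp (exists_norm_Spart_le h0 ha hν)
      (y := 2 * Real.pi * y) (by positivity)).mul_right (Real.exp (2 * Real.pi * (c * y)))
    refine this.congr fun n => ?_
    rw [mul_assoc, ← Real.exp_add]
    congr 2
    ring
  have key := MeasureTheory.hasSum_integral_of_summable_integral_norm hFint hs
  have hval : ∀ n, ∫ u, F n u =
      Spart a ν n * ((1 / h * Real.exp (-(Real.pi * ((n - c) / h) ^ 2)) : ℝ) : ℂ) := by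
    intro n
    simp only [hF]
    rw [MeasureTheory.integral_const_mul, integral_gaussian_mul_fourierExp hh]
  simp_rw [hval] at key
  refine (congrArg (HasSum _) ?_).mp key
  refine MeasureTheory.integral_congr_ae (Eventually.of_forall fun u => Eq.symm ?_)
  simp only
  rw [← (hasSum_Spart_mul_fourierExp h0 ha hν (z := (u : ℂ) + y * I) (by rw [him]; exact hy)).tsum_eq,
    ← tsum_mul_left]
  refine tsum_congr fun n => ?_
  simp only [hF]
  have : ((n - c : ℝ) : ℂ) * (u + y * I) = -c * (u + y * I) + n * (u + y * I) := by
    push_cast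
    ring
  rw [this, fourierExp_add]
  ring

lemma eventually_rpow_mul_exp_neg_rpow_le (K : ℝ) {b p ε : ℝ} (hb : 0 < b) (hp : 0 < p)
    (hε : 0 < ε) : ∀ᶠ c : ℝ in atTop, c ^ K * Real.exp (-(b * c ^ p)) ≤ ε := by
  have h1 := (tendsto_rpow_mul_exp_neg_mul_atTop_nhds_zero (K / p) b hb).comp
    (tendsto_rpow_atTop hp)
  filter_upwards [h1.eventually_le_const hε, eventually_gt_atTop 0] with c hc hc0
  simp only [Function.comp_apply] at hc
  rwa [← Real.rpow_mul hc0.le, mul_div_cancel₀ _ hp.ne', neg_mul] at hc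

lemma integrable_abs_rpow_mul_exp_neg_sq {η : ℝ} (hη : 0 < η) :
    MeasureTheory.Integrable fun u : ℝ => |u| ^ (η - 1) * Real.exp (-u ^ 2) := by
  have h1 : MeasureTheory.IntegrableOn (fun u : ℝ => |u| ^ (η - 1) * Real.exp (-u ^ 2))
      (Set.Ioi 0) := by
    refine (integrableOn_rpow_mul_exp_neg_mul_sq one_pos (s := η - 1) (by linarith)).congr_fun
      (fun u hu => ?_) measurableSet_Ioi
    simp only
    rw [abs_of_pos hu, neg_one_mul]
  rw [← MeasureTheory.integrableOn_univ, ← Set.Iic_union_Ioi (a := (0 : ℝ)),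
    MeasureTheory.integrableOn_union]
  refine ⟨?_, h1⟩
  rw [← MeasureTheory.Measure.map_neg_eq_self (MeasureTheory.volume : MeasureTheory.Measure ℝ)]
  have m : MeasurableEmbedding fun x : ℝ => -x := (Homeomorph.neg ℝ).measurableEmbedding
  rw [m.integrableOn_map_iff]
  simp only [Function.comp_def, abs_neg, Set.neg_preimage, Set.neg_Iic, neg_zero, neg_sq]
  exact Iff.mpr integrableOn_Ici_iff_integrableOn_Ioi h1

lemma norm_le_norm_one_sub_fourierExp {z : ℂ} (hz : ‖z‖ ≤ 1 / 16) :
    ‖z‖ ≤ ‖1 - fourierExp z‖ := by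
  have hw : ‖2 * Real.pi * I * z‖ = 2 * Real.pi * ‖z‖ := by
    simp [abs_of_pos Real.pi_pos]
  have hpi := Real.pi_gt_three
  have hpi' := Real.pi_lt_d2
  have hz0 := norm_nonneg z
  have h1 : 2 * Real.pi * ‖z‖ ≤ 1 / 2 := by nlinarith
  have h2 := norm_exp_sub_one_sub_id_le (x := 2 * Real.pi * I * z) (by rw [hw]; linarith)
  have h3 := norm_sub_norm_le (2 * Real.pi * I * z) (2 * Real.pi * I * z + (1 - fourierExp z))
  have h4 : 2 * Real.pi * I * z - (2 * Real.pi * I * z + (1 - fourierExp z)) =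
      -(1 - fourierExp z) := by ring
  have h5 : ‖2 * Real.pi * I * z + (1 - fourierExp z)‖ =
      ‖cexp (2 * Real.pi * I * z) - 1 - 2 * Real.pi * I * z‖ := by
    rw [← norm_neg, fourierExp]
    congr 1
    ring
  rw [h4, norm_neg, h5] at h3
  rw [hw] at h2 h3
  have h6 : (2 * Real.pi * ‖z‖) ^ 2 ≤ 1 / 2 * (2 * Real.pi * ‖z‖) := by
    rw [sq]
    exact mul_le_mul_of_nonneg_right h1 (by positivity)
  nlinarith

lemma im_le_norm_one_sub_fourierExp {z : ℂ} (hz : 0 < z.im) (hz' : z.im ≤ 1 / 2) :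
    z.im ≤ ‖1 - fourierExp z‖ := by
  have h1 := norm_sub_norm_le (1 : ℂ) (fourierExp z)
  rw [norm_one, norm_fourierExp] at h1
  refine le_trans ?_ h1
  have hpi := Real.pi_gt_three
  have h2 : Real.exp (-(2 * Real.pi * z.im)) ≤ 1 / (1 + 2 * z.im) := by
    rw [Real.exp_neg, ← one_div]
    gcongr
    nlinarith [Real.add_one_le_exp (2 * Real.pi * z.im)]
  have h3 : 1 / (1 + 2 * z.im) ≤ 1 - z.im := by
    rw [div_le_iff₀ (by linarith)]
    nlinarith
  linarith

namespace IsInversionSeries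

variable {j : ℕ} {f : ℂ → ℂ} {a : ℕ → ℂ}

lemma exists_norm_twistedSeries_le (h : IsInversionSeries j f a) {ν : ℝ} (hν : 0 ≤ ν) :
    ∃ (B : ℕ) (C : ℝ), 0 < C ∧ ∀ z : ℂ, 0 < z.im → ‖twistedSeries a ν z‖ ≤ C * (1 / z.im) ^ B := by
  obtain ⟨A, C, ha⟩ := h.coeff_bound
  have hb := fun n => (norm_coeff_mul_rpow_neg_le h.coeff_zero hν n).trans (ha n)
  obtain ⟨C', hC', hle⟩ := exists_tsum_norm_coeff_le (by simp [h.coeff_zero]) hb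
  refine ⟨A + 1, C', hC', fun z hz => ?_⟩
  refine ((norm_tsum_coeff_mul_fourierExp_le hb hz).trans (hle _ hz)).trans ?_
  exact mul_le_of_le_one_right (by positivity) (Real.exp_le_one_iff.mpr (by linarith))

set_option maxHeartbeats 800000 in
lemma exists_norm_gaussian_sum_le (h : IsInversionSeries j f a) {ν : ℝ} (hν : 0 ≤ ν) {θ η : ℝ}
    (hθ : 1 / 2 < θ) (hθ' : θ ≤ 1) (hη : 0 < η) (hη' : η < 1) :
    ∃ C : ℝ, 0 < C ∧ ∀ᶠ c : ℝ in atTop,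
      Summable (fun n : ℕ => Spart a ν n * ((Real.exp (-(Real.pi * ((n - c) / c ^ θ) ^ 2)) : ℝ) : ℂ)) ∧
      ‖∑' n : ℕ, Spart a ν n * ((Real.exp (-(Real.pi * ((n - c) / c ^ θ) ^ 2)) : ℝ) : ℂ)‖ ≤
        C * c ^ (θ + η) := by
  obtain ⟨A, Ca, ha⟩ := h.coeff_bound
  set δ := (θ - 1 / 2) / 2 with hδ
  have hδ0 : 0 < δ := by rw [hδ]; linarith
  obtain ⟨C₁, hC₁, h₁⟩ := h.exists_norm_twistedSeries_le_of_abs_re_le hν hδ0 (by rw [hδ]; linarith)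
  obtain ⟨B, C₂, hC₂, h₂⟩ := h.exists_norm_twistedSeries_le hν
  set K₁ := ∫ u : ℝ, |u| ^ (η - 1) * Real.exp (-u ^ 2) with hK₁
  set K₂ := ∫ u : ℝ, Real.exp (-1 * u ^ 2) with hK₂
  have hK₁0 : 0 ≤ K₁ := MeasureTheory.integral_nonneg fun u => by positivity
  have hK₂0 : 0 ≤ K₂ := MeasureTheory.integral_nonneg fun u => by positivity
  set E := Real.exp Real.pi * Real.exp (2 * Real.pi) with hE
  have hE0 : 0 < E := by positivity
  refine ⟨E * C₁ * Real.exp 1 * K₁ + E * C₂ * K₂ + 1, by positivity, ?_⟩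
  filter_upwards [eventually_ge_atTop (10000 : ℝ),
    eventually_rpow_mul_exp_neg_rpow_le ((B + 1 : ℕ) : ℝ) (b := Real.pi / 2) (p := 2 * δ)
      (by positivity) (by positivity) one_pos] with c hc hcB
  have hc0 : 0 < c := by linarith
  have hc1 : 1 ≤ c := by linarith
  have hh0 : 0 < c ^ θ := by positivity
  have hh1 : 1 ≤ c ^ θ := Real.one_le_rpow hc1 (by linarith)
  have hhc : c ^ θ ≤ c := by simpa using Real.rpow_le_rpow_of_exponent_le hc1 hθ'
  have hy0 : 0 < 1 / c := by positivity
  have key := hasSum_Spart_mul_gaussian h.coeff_zero ha hν hh0 hy0 c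
  set J := ∫ u : ℝ, cexp (-(Real.pi * (c ^ θ : ℝ) ^ 2 * (u + (1 / c : ℝ) * I) ^ 2)) *
    fourierExp (-c * (u + (1 / c : ℝ) * I)) * (twistedSeries a ν (u + (1 / c : ℝ) * I) /
      (1 - fourierExp (u + (1 / c : ℝ) * I))) with hJ
  have key' : HasSum (fun n : ℕ =>
      Spart a ν n * ((Real.exp (-(Real.pi * ((n - c) / c ^ θ) ^ 2)) : ℝ) : ℂ)) ((c ^ θ : ℝ) * J) := by
    refine Eq.mpr (congrArg (fun g => HasSum g _) (funext fun n => ?_))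
      (key.mul_left ((c ^ θ : ℝ) : ℂ))
    have : ((c ^ θ : ℝ) : ℂ) ≠ 0 := by exact_mod_cast hh0.ne'
    rw [ofReal_mul (1 / c ^ θ)]
    push_cast at this ⊢
    field_simp
  refine ⟨key'.summable, ?_⟩
  rw [key'.tsum_eq, norm_mul, Complex.norm_real, Real.norm_of_nonneg hh0.le,
    Real.rpow_add hc0, ← mul_assoc, mul_comm _ (c ^ θ), mul_assoc]
  refine mul_le_mul_of_nonneg_left ?_ hh0.le
  have hcη : 1 ≤ c ^ η := Real.one_le_rpow hc1 hη.le
  suffices hmain : ‖J‖ ≤ ∫ u : ℝ, (E * C₁ * Real.exp 1 * c ^ η) * (|u| ^ (η - 1) * Real.exp (-u ^ 2)) +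
      E * C₂ * Real.exp (-1 * u ^ 2) by
    refine hmain.trans ?_
    rw [MeasureTheory.integral_add ((integrable_abs_rpow_mul_exp_neg_sq hη).const_mul _)
      ((integrable_exp_neg_mul_sq one_pos).const_mul _), MeasureTheory.integral_const_mul,
      MeasureTheory.integral_const_mul]
    have : E * C₂ * K₂ ≤ E * C₂ * K₂ * c ^ η := le_mul_of_one_le_right (by positivity) hcη
    nlinarith
  refine MeasureTheory.norm_integral_le_of_norm_le
    (((integrable_abs_rpow_mul_exp_neg_sq hη).const_mul _).add
      ((integrable_exp_neg_mul_sq one_pos).const_mul _)) ?_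
  have hne : ∀ᵐ u : ℝ, u ≠ 0 := by
    simp [MeasureTheory.ae_iff, MeasureTheory.measure_singleton]
  filter_upwards [hne] with u hu
  set z : ℂ := u + (1 / c : ℝ) * I with hz
  have him : z.im = 1 / c := by simp [hz]
  have hre : z.re = u := by simp [hz]
  have hzim : 0 < z.im := by rw [him]; exact hy0
  have hua : 0 < |u| := abs_pos.mpr hu
  have hg1 : Real.exp (-(Real.pi * (c ^ θ) ^ 2 * (u ^ 2 - (1 / c) ^ 2))) ≤
      Real.exp Real.pi * Real.exp (-(Real.pi * (c ^ θ) ^ 2 * u ^ 2)) := by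
    rw [← Real.exp_add]
    refine Real.exp_le_exp.mpr ?_
    have : (c ^ θ) ^ 2 * (1 / c) ^ 2 ≤ 1 := by
      rw [← mul_pow]
      refine pow_le_one₀ (by positivity) ?_
      rw [mul_one_div, div_le_one hc0]
      exact hhc
    nlinarith [Real.pi_pos]
  have hg2 : ‖fourierExp (-c * z)‖ = Real.exp (2 * Real.pi) := by
    rw [norm_fourierExp]
    have : (-(c : ℂ) * z).im = -1 := by
      rw [← ofReal_neg, im_ofReal_mul, him]
      field_simp
    rw [this]
    congr 1
    ring
  have hG : ‖cexp (-(Real.pi * (c ^ θ : ℝ) ^ 2 * z ^ 2)) * fourierExp (-c * z)‖ ≤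
      E * Real.exp (-(Real.pi * (c ^ θ) ^ 2 * u ^ 2)) := by
    rw [norm_mul, hg2, hz, norm_gaussian, hE]
    calc _ ≤ Real.exp Real.pi * Real.exp (-(Real.pi * (c ^ θ) ^ 2 * u ^ 2)) *
          Real.exp (2 * Real.pi) := by gcongr
      _ = _ := by ring
  rw [norm_mul, norm_div]
  have hu2 : u ^ 2 ≤ (c ^ θ) ^ 2 * u ^ 2 :=
    le_mul_of_one_le_left (sq_nonneg u) (one_le_pow₀ hh1)
  rcases le_or_gt |u| (z.im ^ (1 / 2 + δ)) with hr | hr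
  · have hΦ := h₁ z hzim (by rw [hre]; exact hr)
    have hzn : ‖z‖ ≤ 1 / 16 := by
      have hsq : (1 / c) ^ (1 / 2 + δ) ≤ 1 / 100 := by
        calc (1 / c) ^ (1 / 2 + δ) ≤ (1 / c) ^ (1 / 2 : ℝ) :=
              Real.rpow_le_rpow_of_exponent_ge hy0 (by rw [div_le_one hc0]; exact hc1)
                (by linarith)
          _ = √(1 / c) := (Real.sqrt_eq_rpow _).symm
          _ ≤ √((1 / 100) ^ 2) := by
              apply Real.sqrt_le_sqrt
              rw [div_le_iff₀ hc0]
              linarith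
          _ = 1 / 100 := Real.sqrt_sq (by norm_num)
      have h3 := Complex.norm_le_abs_re_add_abs_im z
      rw [hre, abs_of_pos hzim, him] at h3
      rw [him] at hr
      have : 1 / c ≤ 1 / 10000 := by gcongr
      linarith
    have hzu : |u| ≤ ‖z‖ := by rw [← hre]; exact Complex.abs_re_le_norm z
    have hzy : 1 / c ≤ ‖z‖ := by
      have := Complex.abs_im_le_norm z
      rwa [abs_of_pos hzim, him] at this
    have hzpos : 0 < ‖z‖ := hua.trans_le hzu
    have hinv : 1 / ‖1 - fourierExp z‖ ≤ c ^ η * |u| ^ (η - 1) := by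
      have h4 : |u| ^ (1 - η) * (1 / c) ^ η ≤ ‖z‖ := by
        calc |u| ^ (1 - η) * (1 / c) ^ η ≤ ‖z‖ ^ (1 - η) * ‖z‖ ^ η := by
              gcongr
          _ = ‖z‖ := by rw [← Real.rpow_add hzpos, sub_add_cancel, Real.rpow_one]
      calc 1 / ‖1 - fourierExp z‖ ≤ 1 / (|u| ^ (1 - η) * (1 / c) ^ η) := by
            gcongr
            exact h4.trans (norm_le_norm_one_sub_fourierExp hzn)
        _ = c ^ η * |u| ^ (η - 1) := by
            rw [one_div, mul_inv, ← Real.rpow_neg hua.le, neg_sub, one_div, Real.inv_rpow hc0.le,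
              inv_inv, mul_comm]
    have hexp : Real.exp (-(Real.pi * (c ^ θ) ^ 2 * u ^ 2)) ≤ Real.exp 1 * Real.exp (-u ^ 2) := by
      rw [← Real.exp_add]
      apply Real.exp_le_exp.mpr
      nlinarith [Real.pi_gt_three]
    calc _ ≤ (E * (Real.exp 1 * Real.exp (-u ^ 2))) * (C₁ * (c ^ η * |u| ^ (η - 1))) := by
          rw [div_eq_mul_one_div]
          gcongr
          exact hG.trans (by gcongr)
      _ = (E * C₁ * Real.exp 1 * c ^ η) * (|u| ^ (η - 1) * Real.exp (-u ^ 2)) := by ring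
      _ ≤ _ := le_add_of_nonneg_right (by positivity)
  · have hΦ := h₂ z hzim
    have hden := im_le_norm_one_sub_fourierExp hzim (by
      rw [him, div_le_div_iff₀ hc0 two_pos]; linarith)
    rw [him, one_div_one_div] at hΦ
    rw [him] at hden hr
    have hu3 : c ^ (2 * δ) ≤ (c ^ θ) ^ 2 * u ^ 2 := by
      have h5 : c ^ (-(1 / 2 + δ)) ≤ |u| := by
        rw [Real.rpow_neg hc0.le, ← Real.inv_rpow hc0.le, ← one_div]
        exact hr.le
      calc c ^ (2 * δ) = (c ^ θ * c ^ (-(1 / 2 + δ))) ^ 2 := by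
            rw [← Real.rpow_add hc0, ← Real.rpow_natCast, ← Real.rpow_mul hc0.le]
            congr 1
            push_cast
            rw [hδ]
            ring
        _ ≤ (c ^ θ * |u|) ^ 2 := by gcongr
        _ = _ := by rw [mul_pow, sq_abs]
    have hexp : Real.exp (-(Real.pi * (c ^ θ) ^ 2 * u ^ 2)) ≤
        Real.exp (-(Real.pi / 2 * c ^ (2 * δ))) * Real.exp (-1 * u ^ 2) := by
      rw [← Real.exp_add]
      apply Real.exp_le_exp.mpr
      nlinarith [Real.pi_gt_three]
    calc _ ≤ (E * (Real.exp (-(Real.pi / 2 * c ^ (2 * δ))) * Real.exp (-1 * u ^ 2))) *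
            ((C₂ * c ^ B) / (1 / c)) := by
          gcongr
          exact hG.trans (by gcongr)
      _ = (c ^ (B + 1) * Real.exp (-(Real.pi / 2 * c ^ (2 * δ)))) *
            (E * C₂ * Real.exp (-1 * u ^ 2)) := by
          rw [div_div_eq_mul_div, div_one]
          ring
      _ ≤ 1 * (E * C₂ * Real.exp (-1 * u ^ 2)) := by
          rw [Real.rpow_natCast] at hcB
          gcongr
      _ ≤ _ := by
          rw [one_mul]
          exact le_add_of_nonneg_left (by positivity)

end IsInversionSeries

/-- The exponential kernel concentrating at the stationary point `w₀` of the phase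
`n₀ w + n₀ w₀² / w`. -/
noncomputable def stationaryPhase (n₀ : ℕ) (w₀ L x : ℝ) (w : ℂ) : ℂ :=
  cexp (-((1 / L ^ 2 : ℝ) - (2 * Real.pi * n₀ / w₀ : ℝ) * I) * (w - w₀) ^ 2) *
    fourierExp (-(n₀ * w)) * fourierExp (-(x / w))

noncomputable def stationaryIntegral (n₀ j : ℕ) (w₀ L x : ℝ) : ℂ :=
  ∫ u in w₀ / 2..3 * w₀ / 2, stationaryPhase n₀ w₀ L x (u + I) / (u + I) ^ (2 * j)

lemma stationaryPhase_exponent_le {n₀ w₀ L u y x : ℝ} (hn : 0 ≤ n₀) (hw : 0 < w₀) (hL : 0 < L)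
    (hLw : 64 * Real.pi * n₀ * L ^ 3 ≤ w₀ ^ 2) (hu : w₀ / 2 ≤ u) (hu' : u ≤ 3 * w₀ / 2)
    (hy : |y| ≤ L) :
    -(((u - w₀) ^ 2 - y ^ 2) / L ^ 2) - 2 * (2 * Real.pi * n₀ / w₀) * (u - w₀) * y +
        2 * Real.pi * (n₀ * y) - 2 * Real.pi * (x * y / (u ^ 2 + y ^ 2)) ≤
      2 - (u - w₀) ^ 2 / (2 * L ^ 2) + 2 * Real.pi * y * (n₀ * w₀ ^ 2 - x) / (u ^ 2 + y ^ 2) := by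
  have hu0 : 0 < u := by linarith
  have hpi := Real.pi_pos
  obtain ⟨v, rfl⟩ : ∃ v, u = w₀ + v := ⟨u - w₀, by ring⟩
  have hq : 0 < (w₀ + v) ^ 2 + y ^ 2 := by positivity
  set B := 1 / w₀ ^ 2 - 2 * v / w₀ ^ 3 - 1 / ((w₀ + v) ^ 2 + y ^ 2) with hB
  have hBeq : B = y ^ 2 / ((w₀ + v) ^ 2 * ((w₀ + v) ^ 2 + y ^ 2)) -
      v ^ 2 * (3 * w₀ + 2 * v) / ((w₀ + v) ^ 2 * w₀ ^ 3) := by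
    rw [hB]
    field_simp
    ring
  have hu2 : w₀ ^ 2 / 4 ≤ (w₀ + v) ^ 2 := by nlinarith
  have h1 : y ^ 2 / ((w₀ + v) ^ 2 * ((w₀ + v) ^ 2 + y ^ 2)) ≤ 16 * y ^ 2 / w₀ ^ 4 := by
    calc _ ≤ y ^ 2 / (w₀ ^ 2 / 4 * (w₀ ^ 2 / 4)) := by
          gcongr
          nlinarith [sq_nonneg y]
      _ = _ := by field_simp; ring
  have h1' : 0 ≤ y ^ 2 / ((w₀ + v) ^ 2 * ((w₀ + v) ^ 2 + y ^ 2)) := by positivity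
  have h2 : v ^ 2 * (3 * w₀ + 2 * v) / ((w₀ + v) ^ 2 * w₀ ^ 3) ≤ 16 * v ^ 2 / w₀ ^ 4 := by
    calc _ ≤ v ^ 2 * (4 * w₀) / (w₀ ^ 2 / 4 * w₀ ^ 3) := by
          gcongr
          linarith
      _ = _ := by field_simp; ring
  have h2' : 0 ≤ v ^ 2 * (3 * w₀ + 2 * v) / ((w₀ + v) ^ 2 * w₀ ^ 3) := by
    have : 0 ≤ 3 * w₀ + 2 * v := by linarith
    positivity
  have hBabs : |B| ≤ 16 * (v ^ 2 + y ^ 2) / w₀ ^ 4 := by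
    have : 16 * (v ^ 2 + y ^ 2) / w₀ ^ 4 = 16 * v ^ 2 / w₀ ^ 4 + 16 * y ^ 2 / w₀ ^ 4 := by ring
    rw [this, hBeq, abs_le]
    have : 0 ≤ 16 * v ^ 2 / w₀ ^ 4 := by positivity
    have : 0 ≤ 16 * y ^ 2 / w₀ ^ 4 := by positivity
    constructor <;> linarith
  have hmain : 2 * Real.pi * n₀ * w₀ ^ 2 * y * B ≤ (v ^ 2 + y ^ 2) / (2 * L ^ 2) := by
    calc 2 * Real.pi * n₀ * w₀ ^ 2 * y * B ≤ |2 * Real.pi * n₀ * w₀ ^ 2 * y * B| := le_abs_self _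
      _ = 2 * Real.pi * n₀ * w₀ ^ 2 * (|y| * |B|) := by
          rw [abs_mul, abs_mul, abs_of_nonneg (by positivity : 0 ≤ 2 * Real.pi * n₀ * w₀ ^ 2)]
          ring
      _ ≤ 2 * Real.pi * n₀ * w₀ ^ 2 * (L * (16 * (v ^ 2 + y ^ 2) / w₀ ^ 4)) := by gcongr
      _ = (v ^ 2 + y ^ 2) * (32 * Real.pi * n₀ * L / w₀ ^ 2) := by field_simp; ring
      _ ≤ (v ^ 2 + y ^ 2) * (1 / (2 * L ^ 2)) := by
          gcongr (v ^ 2 + y ^ 2) * ?_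
          rw [div_le_div_iff₀ (by positivity) (by positivity)]
          linarith
      _ = _ := by ring
  have hy2 : y ^ 2 / L ^ 2 ≤ 1 := by
    rw [div_le_one (by positivity), ← sq_abs]
    gcongr
  have hE : -(((w₀ + v - w₀) ^ 2 - y ^ 2) / L ^ 2) - 2 * (2 * Real.pi * n₀ / w₀) * (w₀ + v - w₀) * y +
        2 * Real.pi * (n₀ * y) - 2 * Real.pi * (x * y / ((w₀ + v) ^ 2 + y ^ 2)) =
      -(v ^ 2 / L ^ 2) + y ^ 2 / L ^ 2 + 2 * Real.pi * n₀ * w₀ ^ 2 * y * B +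
        2 * Real.pi * y * (n₀ * w₀ ^ 2 - x) / ((w₀ + v) ^ 2 + y ^ 2) := by
    rw [hB]
    field_simp
    ring
  have h3 : (v ^ 2 + y ^ 2) / (2 * L ^ 2) = v ^ 2 / L ^ 2 / 2 + y ^ 2 / L ^ 2 / 2 := by
    field_simp
  have h4 : (w₀ + v - w₀) ^ 2 / (2 * L ^ 2) = v ^ 2 / L ^ 2 / 2 := by
    rw [add_sub_cancel_left]
    field_simp
  rw [hE, h4]
  linarith

lemma norm_cexp_stationary (α b v y : ℝ) :
    ‖cexp (-((α : ℝ) - (b : ℝ) * I) * (v + y * I) ^ 2)‖ =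
      Real.exp (-(α * (v ^ 2 - y ^ 2)) - 2 * b * v * y) := by
  rw [Complex.norm_exp]
  congr 1
  have : (-((α : ℝ) - (b : ℝ) * I) * (v + y * I) ^ 2 : ℂ) =
      ((-(α * (v ^ 2 - y ^ 2)) - 2 * b * v * y : ℝ) : ℂ) +
        ((b * (v ^ 2 - y ^ 2) - 2 * α * v * y : ℝ) : ℂ) * I := by
    push_cast
    ring_nf
    simp only [I_sq, I_pow_three]
    ring
  rw [this, add_re, ofReal_re, re_ofReal_mul, I_re, mul_zero, add_zero]

lemma norm_stationaryPhase (n₀ : ℕ) (w₀ L x u y : ℝ) :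
    ‖stationaryPhase n₀ w₀ L x (u + y * I)‖ =
      Real.exp (-(((u - w₀) ^ 2 - y ^ 2) / L ^ 2) - 2 * (2 * Real.pi * n₀ / w₀) * (u - w₀) * y +
        2 * Real.pi * (n₀ * y) - 2 * Real.pi * (x * y / (u ^ 2 + y ^ 2))) := by
  have h1 : (u : ℂ) + y * I - w₀ = ((u - w₀ : ℝ) : ℂ) + y * I := by push_cast; ring
  have h2 : (-((n₀ : ℂ) * (u + y * I))).im = -(n₀ * y) := by simp
  have h3 : (-((x : ℂ) / (u + y * I))).im = x * y / (u ^ 2 + y ^ 2) := by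
    rw [neg_im, div_eq_mul_inv, im_ofReal_mul, inv_im, normSq_add_mul_I]
    simp
    ring
  rw [stationaryPhase, h1, norm_mul, norm_mul, norm_cexp_stationary, norm_fourierExp,
    norm_fourierExp, h2, h3, ← Real.exp_add, ← Real.exp_add]
  congr 1
  ring

lemma norm_stationaryPhase_div_le {n₀ : ℕ} {w₀ L u y x : ℝ} (j : ℕ) (hw : 0 < w₀) (hL : 0 < L)
    (hLw : 64 * Real.pi * n₀ * L ^ 3 ≤ w₀ ^ 2) (hu : w₀ / 2 ≤ u) (hu' : u ≤ 3 * w₀ / 2)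
    (hy : |y| ≤ L) :
    ‖stationaryPhase n₀ w₀ L x (u + y * I) / (u + y * I) ^ (2 * j)‖ ≤
      (2 / w₀) ^ (2 * j) * Real.exp (2 - (u - w₀) ^ 2 / (2 * L ^ 2) +
        2 * Real.pi * y * (n₀ * w₀ ^ 2 - x) / (u ^ 2 + y ^ 2)) := by
  have hnorm : w₀ / 2 ≤ ‖(u : ℂ) + y * I‖ := by
    have := Complex.abs_re_le_norm ((u : ℂ) + y * I)
    simp only [add_re, ofReal_re, mul_re, I_re, mul_zero, ofReal_im, I_im, mul_one, sub_self,
      add_zero] at this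
    linarith [le_abs_self u]
  rw [norm_div, norm_pow, div_eq_inv_mul, norm_stationaryPhase]
  gcongr ?_ * ?_
  · rw [← inv_pow]
    gcongr
    rw [← inv_div]
    gcongr
  · exact Real.exp_le_exp.mpr
      (stationaryPhase_exponent_le (Nat.cast_nonneg _) hw hL hLw hu hu' hy)

lemma differentiableOn_stationaryPhase_div (n₀ j : ℕ) (w₀ L x : ℝ) :
    DifferentiableOn ℂ (fun w : ℂ => stationaryPhase n₀ w₀ L x w / w ^ (2 * j)) {0}ᶜ := by
  intro w hw
  have hw' : w ≠ 0 := hw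
  have := differentiable_fourierExp
  refine DifferentiableAt.differentiableWithinAt ?_
  refine DifferentiableAt.div ?_ (by fun_prop) (pow_ne_zero _ hw')
  unfold stationaryPhase
  refine DifferentiableAt.mul (DifferentiableAt.mul (by fun_prop) ?_) ?_
  · exact (differentiable_fourierExp _).comp w (by fun_prop)
  · exact (differentiable_fourierExp _).comp w (by fun_prop (disch := assumption))

lemma integral_gaussian_window_le {w₀ L : ℝ} (hw : 0 < w₀) (hL : 0 < L) :
    ∫ u in w₀ / 2..3 * w₀ / 2, Real.exp (-((u - w₀) ^ 2 / (2 * L ^ 2))) ≤ 3 * L := by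
  have hintegrable : MeasureTheory.Integrable fun u : ℝ => Real.exp (-(1 / (2 * L ^ 2)) * u ^ 2) :=
    integrable_exp_neg_mul_sq (by positivity)
  have heq : (fun u : ℝ => Real.exp (-((u - w₀) ^ 2 / (2 * L ^ 2)))) =
      fun u => (fun u : ℝ => Real.exp (-(1 / (2 * L ^ 2)) * u ^ 2)) (u - w₀) := by
    funext u
    simp only
    congr 1
    ring
  rw [intervalIntegral.integral_of_le (by linarith)]
  calc _ ≤ ∫ u : ℝ, Real.exp (-((u - w₀) ^ 2 / (2 * L ^ 2))) := by
        refine MeasureTheory.setIntegral_le_integral ?_ (Eventually.of_forall fun u => by positivity)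
        rw [heq]
        exact hintegrable.comp_sub_right w₀
    _ = √(Real.pi / (1 / (2 * L ^ 2))) := by
        rw [heq, MeasureTheory.integral_sub_right_eq_self
          (fun u : ℝ => Real.exp (-(1 / (2 * L ^ 2)) * u ^ 2)), integral_gaussian]
    _ ≤ √((3 * L) ^ 2) := by
        apply Real.sqrt_le_sqrt
        rw [div_div_eq_mul_div, div_one]
        nlinarith [Real.pi_lt_d2, sq_nonneg L, mul_pos hL hL]
    _ = 3 * L := Real.sqrt_sq (by positivity)

lemma norm_intervalIntegral_le_of_gaussian {w₀ L M : ℝ} (hw : 0 < w₀) (hL : 0 < L) (hM : 0 ≤ M)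
    {g : ℝ → ℂ} (hg : ∀ u, w₀ / 2 ≤ u → u ≤ 3 * w₀ / 2 →
      ‖g u‖ ≤ M * Real.exp (-((u - w₀) ^ 2 / (2 * L ^ 2)))) :
    ‖∫ u in w₀ / 2..3 * w₀ / 2, g u‖ ≤ M * (3 * L) := by
  refine (intervalIntegral.norm_integral_le_of_norm_le (by linarith)
    (Eventually.of_forall fun u hu => hg u hu.1.le hu.2) ?_).trans ?_
  · exact Continuous.intervalIntegrable (by fun_prop) _ _
  · rw [intervalIntegral.integral_const_mul]
    gcongr
    exact integral_gaussian_window_le hw hL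

lemma norm_stationaryPhase_div_le_window {n₀ : ℕ} {w₀ L u x : ℝ} (j : ℕ) (hw : 0 < w₀) (hL : 1 ≤ L)
    (hLw : 64 * Real.pi * n₀ * L ^ 3 ≤ w₀ ^ 2) (hx : 8 * Real.pi * |x - n₀ * w₀ ^ 2| ≤ w₀ ^ 2)
    (hu : w₀ / 2 ≤ u) (hu' : u ≤ 3 * w₀ / 2) :
    ‖stationaryPhase n₀ w₀ L x (u + I) / (u + I) ^ (2 * j)‖ ≤
      (2 / w₀) ^ (2 * j) * Real.exp 3 * Real.exp (-((u - w₀) ^ 2 / (2 * L ^ 2))) := by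
  have h1 := norm_stationaryPhase_div_le (x := x) (y := 1) j hw (by linarith) hLw hu hu'
    (by rwa [abs_one])
  rw [ofReal_one, one_mul] at h1
  refine h1.trans ?_
  rw [mul_assoc _ (Real.exp 3), ← Real.exp_add]
  gcongr (2 / w₀) ^ (2 * j) * Real.exp ?_
  have h2 : 2 * Real.pi * 1 * (n₀ * w₀ ^ 2 - x) / (u ^ 2 + 1 ^ 2) ≤ 1 := by
    rw [div_le_one (by positivity)]
    have := neg_le_abs (x - n₀ * w₀ ^ 2)
    nlinarith [Real.pi_pos]
  linarith

lemma norm_stationaryIntegral_le {n₀ : ℕ} {w₀ L x : ℝ} (j : ℕ) (hw : 0 < w₀) (hL : 1 ≤ L)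
    (hLw : 64 * Real.pi * n₀ * L ^ 3 ≤ w₀ ^ 2) (hx : 8 * Real.pi * |x - n₀ * w₀ ^ 2| ≤ w₀ ^ 2) :
    ‖stationaryIntegral n₀ j w₀ L x‖ ≤ (2 / w₀) ^ (2 * j) * Real.exp 3 * (3 * L) :=
  norm_intervalIntegral_le_of_gaussian hw (by linarith) (by positivity) fun _ hu hu' =>
    norm_stationaryPhase_div_le_window j hw hL hLw hx hu hu'

lemma continuous_stationaryPhase_div_line (n₀ j : ℕ) (w₀ L x : ℝ) {y : ℝ} (hy : y ≠ 0) :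
    Continuous fun u : ℝ => stationaryPhase n₀ w₀ L x (u + y * I) / ((u : ℂ) + y * I) ^ (2 * j) := by
  refine (differentiableOn_stationaryPhase_div n₀ j w₀ L x).continuousOn.comp_continuous
    (f := fun u : ℝ => (u : ℂ) + y * I) (by fun_prop) fun u hu => ?_
  have : ((u : ℂ) + y * I).im = 0 := by rw [hu]; rfl
  simp at this
  exact hy this

lemma norm_stationaryIntegral_sub_le {n₀ : ℕ} {w₀ L x : ℝ} (j : ℕ) (hw : 16 ≤ w₀) (hL : 1 ≤ L)
    (hLw : 64 * Real.pi * n₀ * L ^ 3 ≤ w₀ ^ 2) (hx : 8 * Real.pi * |x - n₀ * w₀ ^ 2| ≤ w₀ ^ 2) :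
    ‖stationaryIntegral n₀ j w₀ L x - stationaryIntegral n₀ j w₀ L (x + 1)‖ ≤
      (2 / w₀) ^ (2 * j + 1) * (14 * Real.exp 3) * (3 * L) := by
  have hw0 : 0 < w₀ := by linarith
  have hcont : ∀ x, IntervalIntegrable (fun u : ℝ => stationaryPhase n₀ w₀ L x (u + I) /
      (u + I) ^ (2 * j)) MeasureTheory.volume (w₀ / 2) (3 * w₀ / 2) := fun x => by
    have := continuous_stationaryPhase_div_line n₀ j w₀ L x one_ne_zero
    simp only [ofReal_one, one_mul] at this
    exact this.intervalIntegrable _ _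
  rw [stationaryIntegral, stationaryIntegral, ← intervalIntegral.integral_sub (hcont _) (hcont _)]
  refine norm_intervalIntegral_le_of_gaussian hw0 (by linarith) (by positivity) fun u hu hu' => ?_
  have h1 := norm_stationaryPhase_div_le_window j hw0 hL hLw hx hu hu'
  have hnorm : w₀ / 2 ≤ ‖(u : ℂ) + I‖ := by
    have := Complex.abs_re_le_norm ((u : ℂ) + I)
    simp only [add_re, ofReal_re, I_re, add_zero] at this
    linarith [le_abs_self u]
  have hpos : 0 < ‖(u : ℂ) + I‖ := by linarith
  have hfac : stationaryPhase n₀ w₀ L x (u + I) / (u + I) ^ (2 * j) -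
      stationaryPhase n₀ w₀ L (x + 1) (u + I) / (u + I) ^ (2 * j) =
      stationaryPhase n₀ w₀ L x (u + I) / (u + I) ^ (2 * j) * (1 - fourierExp (-(1 / (u + I)))) := by
    have : -(((x + 1 : ℝ) : ℂ) / (u + I)) = -(x / (u + I)) + -(1 / (u + I)) := by
      push_cast
      ring
    rw [stationaryPhase, stationaryPhase, this, fourierExp_add]
    ring
  have h2 : ‖1 - fourierExp (-(1 / ((u : ℂ) + I)))‖ ≤ 14 * (2 / w₀) := by
    have h3 : ‖2 * Real.pi * I * -(1 / ((u : ℂ) + I))‖ ≤ 7 * (2 / w₀) := by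
      have : ‖2 * Real.pi * I * -(1 / ((u : ℂ) + I))‖ = 2 * Real.pi * ‖(u : ℂ) + I‖⁻¹ := by
        simp [abs_of_pos Real.pi_pos]
      rw [this]
      have h4 : ‖(u : ℂ) + I‖⁻¹ ≤ 2 / w₀ := by
        rw [← inv_div]
        gcongr
      gcongr
      linarith [Real.pi_lt_d2]
    have h5 : 7 * (2 / w₀) ≤ 1 := by
      rw [← mul_div_assoc, div_le_one hw0]
      linarith
    rw [norm_sub_rev]
    refine (norm_exp_sub_one_le (h3.trans h5)).trans ?_
    linarith
  rw [hfac, norm_mul]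
  calc _ ≤ ((2 / w₀) ^ (2 * j) * Real.exp 3 * Real.exp (-((u - w₀) ^ 2 / (2 * L ^ 2)))) *
        (14 * (2 / w₀)) := by gcongr
    _ = _ := by ring

/-- Shifting the contour to height `Y`. -/
lemma norm_stationaryIntegral_le_of_shift {n₀ j : ℕ} {w₀ L x Y Q : ℝ} (hw : 0 < w₀)
    (hY : |Y| ≤ L)
    (hline : ∀ u, w₀ / 2 ≤ u → u ≤ 3 * w₀ / 2 →
      ‖stationaryPhase n₀ w₀ L x (u + Y * I) / (u + Y * I) ^ (2 * j)‖ ≤ Q)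
    (hside : ∀ u, (u = w₀ / 2 ∨ u = 3 * w₀ / 2) → ∀ y ∈ Set.uIcc 1 Y,
      ‖stationaryPhase n₀ w₀ L x ((u : ℝ) + y * I) / ((u : ℝ) + y * I) ^ (2 * j)‖ ≤ Q) :
    ‖stationaryIntegral n₀ j w₀ L x‖ ≤ (w₀ + 2 * (L + 1)) * Q := by
  have hQ : 0 ≤ Q := (norm_nonneg _).trans (hline w₀ (by linarith) (by linarith))
  set g : ℂ → ℂ := fun w => stationaryPhase n₀ w₀ L x w / w ^ (2 * j) with hg
  have key := Complex.integral_boundary_rect_eq_zero_of_differentiableOn g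
    (((w₀ / 2 : ℝ) : ℂ) + (1 : ℝ) * I) (((3 * w₀ / 2 : ℝ) : ℂ) + Y * I) (by
      refine (differentiableOn_stationaryPhase_div n₀ j w₀ L x).mono fun w hw' => ?_
      rw [Complex.mem_reProdIm] at hw'
      intro h0
      have h1 := hw'.1
      rw [h0] at h1
      simp only [add_re, ofReal_re, mul_re, I_re, mul_zero, ofReal_im, I_im, mul_one, sub_self,
        add_zero, zero_re] at h1
      rw [Set.uIcc_of_le (by linarith)] at h1
      linarith [h1.1])
  simp only [add_re, ofReal_re, mul_re, I_re, mul_zero, ofReal_im, I_im, mul_one, sub_self,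
    add_zero, add_im, mul_im, zero_add] at key
  have hSI : stationaryIntegral n₀ j w₀ L x =
      ∫ u in w₀ / 2..3 * w₀ / 2, g ((u : ℂ) + (1 : ℝ) * I) := by
    rw [stationaryIntegral]
    simp only [hg, ofReal_one, one_mul]
  rw [← hSI] at key
  have heq : stationaryIntegral n₀ j w₀ L x =
      (∫ u in w₀ / 2..3 * w₀ / 2, g ((u : ℂ) + Y * I)) -
      I • (∫ y in (1 : ℝ)..Y, g (((3 * w₀ / 2 : ℝ) : ℂ) + y * I)) +
      I • ∫ y in (1 : ℝ)..Y, g (((w₀ / 2 : ℝ) : ℂ) + y * I) := by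
    linear_combination key
  have hYL : |Y - 1| ≤ L + 1 := by
    refine (abs_sub _ _).trans ?_
    rw [abs_one]
    linarith
  have b1 : ‖∫ u in w₀ / 2..3 * w₀ / 2, g ((u : ℂ) + Y * I)‖ ≤ Q * w₀ := by
    have := intervalIntegral.norm_integral_le_of_norm_le_const (a := w₀ / 2) (b := 3 * w₀ / 2)
      (f := fun u : ℝ => g ((u : ℂ) + Y * I)) (C := Q) (fun u hu => by
        rw [Set.uIoc_of_le (by linarith)] at hu
        exact hline u hu.1.le hu.2)
    have h2 : |3 * w₀ / 2 - w₀ / 2| = w₀ := by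
      rw [abs_of_nonneg] <;> linarith
    rwa [h2] at this
  have b2 : ∀ u : ℝ, (u = w₀ / 2 ∨ u = 3 * w₀ / 2) →
      ‖I • ∫ y in (1 : ℝ)..Y, g ((u : ℂ) + y * I)‖ ≤ Q * (L + 1) := fun u hu => by
    rw [norm_smul, norm_I, one_mul]
    refine (intervalIntegral.norm_integral_le_of_norm_le_const (C := Q) fun y hy =>
      hside u hu y (Set.uIoc_subset_uIcc hy)).trans ?_
    gcongr
  rw [heq]
  refine (norm_add_le _ _).trans ?_
  have := norm_sub_le (∫ u in w₀ / 2..3 * w₀ / 2, g ((u : ℂ) + Y * I))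
    (I • (∫ y in (1 : ℝ)..Y, g (((3 * w₀ / 2 : ℝ) : ℂ) + y * I)))
  linarith [b2 _ (Or.inl rfl), b2 _ (Or.inr rfl)]

lemma norm_stationaryIntegral_le_tail {n₀ : ℕ} {w₀ L x T M : ℝ} (j : ℕ) (hn : 1 ≤ n₀) (hw : 2 ≤ w₀)
    (hL : 2 ≤ L) (hLw : 64 * Real.pi * n₀ * L ^ 3 ≤ w₀ ^ 2) (hM : M ≤ w₀ ^ 2 / (8 * L ^ 2))
    (hM' : M ≤ L * T / (2 * w₀ ^ 2)) (hx0 : 0 ≤ x) (hT : 0 ≤ T) (hx : T ≤ |x - n₀ * w₀ ^ 2|) :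
    ‖stationaryIntegral n₀ j w₀ L x‖ ≤
      5 * w₀ * Real.exp (3 + 8 * Real.pi * n₀ - M - x / (n₀ * w₀ ^ 2)) := by
  have hw0 : 0 < w₀ := by linarith
  have hL0 : 0 < L := by linarith
  have hn1 : (1 : ℝ) ≤ n₀ := by exact_mod_cast hn
  have hpi := Real.pi_gt_three
  set c := (n₀ : ℝ) * w₀ ^ 2 with hc
  have hcw : w₀ ^ 2 ≤ c := le_mul_of_one_le_left (by positivity) hn1
  have hc0 : 0 < c := lt_of_lt_of_le (by positivity) hcw
  have hLw0 : L ^ 2 ≤ w₀ ^ 2 := by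
    have h1 : L ^ 2 ≤ L ^ 3 := pow_le_pow_right₀ (by linarith) (by norm_num)
    have h2 : 1 * L ^ 3 ≤ 64 * Real.pi * n₀ * L ^ 3 := by
      gcongr
      nlinarith
    linarith
  have hLle : L ≤ w₀ := by
    have := abs_le_of_sq_le_sq hLw0 hw0.le
    exact (le_abs_self L).trans this
  have hpow : (2 / w₀) ^ (2 * j) ≤ 1 := pow_le_one₀ (by positivity) (by rwa [div_le_one hw0])
  set Q := Real.exp (3 + 8 * Real.pi * n₀ - M - x / c) with hQ
  suffices hs : ‖stationaryIntegral n₀ j w₀ L x‖ ≤ (w₀ + 2 * (L + 1)) * Q by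
    refine hs.trans ?_
    gcongr
    linarith
  have hbound : ∀ u y, w₀ / 2 ≤ u → u ≤ 3 * w₀ / 2 → |y| ≤ L →
      2 - (u - w₀) ^ 2 / (2 * L ^ 2) + 2 * Real.pi * y * (c - x) / (u ^ 2 + y ^ 2) ≤
        3 + 8 * Real.pi * n₀ - M - x / c →
      ‖stationaryPhase n₀ w₀ L x ((u : ℝ) + (y : ℝ) * I) / ((u : ℝ) + (y : ℝ) * I) ^ (2 * j)‖ ≤ Q := by
    intro u y hu hu' hy hexp
    refine (norm_stationaryPhase_div_le (x := x) j hw0 hL0 hLw hu hu' hy).trans ?_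
    exact (mul_le_of_le_one_left (Real.exp_pos _).le hpow).trans (Real.exp_le_exp.mpr hexp)
  have hden : ∀ u y, w₀ / 2 ≤ u → u ≤ 3 * w₀ / 2 → |y| ≤ L → u ^ 2 + y ^ 2 ≤ 4 * w₀ ^ 2 := by
    intro u y hu hu' hy
    have : y ^ 2 ≤ L ^ 2 := by rw [← sq_abs]; gcongr
    nlinarith
  have hsideM : ∀ u, (u = w₀ / 2 ∨ u = 3 * w₀ / 2) → M ≤ (u - w₀) ^ 2 / (2 * L ^ 2) := by
    rintro u (rfl | rfl) <;>
    · refine hM.trans_eq ?_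
      field_simp
      ring
  have hn8 : 0 ≤ 8 * Real.pi * n₀ := by positivity
  rcases le_total c x with hcx | hcx
  · rw [abs_of_nonneg (by linarith)] at hx
    have hxc : x / c ≤ 1 + (x - c) / w₀ ^ 2 := by
      have : x / c = 1 + (x - c) / c := by field_simp; ring
      rw [this]
      have h0 : 0 ≤ x - c := by linarith
      gcongr
    have hdec : ∀ u y, w₀ / 2 ≤ u → u ≤ 3 * w₀ / 2 → |y| ≤ L → 1 ≤ y →
        2 * Real.pi * y * (c - x) / (u ^ 2 + y ^ 2) ≤ -(3 / 2 * y * ((x - c) / w₀ ^ 2)) := by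
      intro u y hu hu' hy hy1
      have h1 : 3 / 2 * y * ((x - c) / w₀ ^ 2) = 6 * y * (x - c) / (4 * w₀ ^ 2) := by
        field_simp
        ring
      have h2 : 2 * Real.pi * y * (c - x) / (u ^ 2 + y ^ 2) =
          -(2 * Real.pi * y * (x - c) / (u ^ 2 + y ^ 2)) := by ring
      have h0 : 0 ≤ x - c := by linarith
      rw [h1, h2]
      apply neg_le_neg
      have := hden u y hu hu' hy
      gcongr
      linarith
    have hp : 0 ≤ (x - c) / w₀ ^ 2 := div_nonneg (by linarith) (by positivity)
    refine norm_stationaryIntegral_le_of_shift (Y := L) hw0 (abs_of_pos hL0).le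
      (fun u hu hu' => hbound u L hu hu' (abs_of_pos hL0).le ?_)
      (fun u hu y hy => ?_)
    · have h1 := hdec u L hu hu' (abs_of_pos hL0).le (by linarith)
      have h2 : L * T / (2 * w₀ ^ 2) ≤ L * ((x - c) / w₀ ^ 2) / 2 := by
        have : L * ((x - c) / w₀ ^ 2) / 2 = L * (x - c) / (2 * w₀ ^ 2) := by field_simp
        rw [this]
        gcongr
      have h3 : 0 ≤ (u - w₀) ^ 2 / (2 * L ^ 2) := by positivity
      nlinarith
    · rw [Set.uIcc_of_le (by linarith)] at hy
      have hu1 : w₀ / 2 ≤ u := by rcases hu with rfl | rfl <;> linarith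
      have hu2 : u ≤ 3 * w₀ / 2 := by rcases hu with rfl | rfl <;> linarith
      have hyL : |y| ≤ L := abs_le.mpr ⟨by linarith [hy.1], hy.2⟩
      refine hbound u y hu1 hu2 hyL ?_
      have h1 := hdec u y hu1 hu2 hyL hy.1
      have h2 := hsideM u hu
      nlinarith [hy.1]
  · rw [abs_of_nonpos (by linarith)] at hx
    have hxc : x / c ≤ 1 := (div_le_one hc0).mpr hcx
    have hLabs : |-L| ≤ L := by rw [abs_neg, abs_of_pos hL0]
    refine norm_stationaryIntegral_le_of_shift (Y := -L) hw0 hLabs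
      (fun u hu hu' => hbound u (-L) hu hu' hLabs ?_)
      (fun u hu y hy => ?_)
    · have h1 : L * T / (2 * w₀ ^ 2) ≤ 2 * Real.pi * L * (c - x) / (u ^ 2 + (-L) ^ 2) := by
        calc L * T / (2 * w₀ ^ 2) = 2 * L * T / (4 * w₀ ^ 2) := by field_simp; ring
          _ ≤ _ := by
            have := hden u (-L) hu hu' hLabs
            have h0 : 0 ≤ c - x := by linarith
            have hp : 0 < u ^ 2 + (-L) ^ 2 := add_pos_of_nonneg_of_pos (sq_nonneg u) (by rw [neg_sq]; positivity)
            have hTx : T ≤ c - x := by linarith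
            have hp2 : 2 ≤ 2 * Real.pi := by linarith
            gcongr
      have h2 : 2 * Real.pi * -L * (c - x) / (u ^ 2 + (-L) ^ 2) =
          -(2 * Real.pi * L * (c - x) / (u ^ 2 + (-L) ^ 2)) := by ring
      have h3 : 0 ≤ (u - w₀) ^ 2 / (2 * L ^ 2) := by positivity
      rw [h2]
      linarith
    · rw [Set.uIcc_of_ge (by linarith)] at hy
      have hu1 : w₀ / 2 ≤ u := by rcases hu with rfl | rfl <;> linarith
      have hu2 : u ≤ 3 * w₀ / 2 := by rcases hu with rfl | rfl <;> linarith
      have hyL : |y| ≤ L := abs_le.mpr ⟨hy.1, by linarith [hy.2]⟩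
      refine hbound u y hu1 hu2 hyL ?_
      have h2 := hsideM u hu
      have h3 : 2 * Real.pi * y * (c - x) / (u ^ 2 + y ^ 2) ≤ 8 * Real.pi * n₀ := by
        have hu0 : 0 < u := by linarith
        rw [div_le_iff₀ (by positivity)]
        have h4 : w₀ ^ 2 / 4 ≤ u ^ 2 + y ^ 2 := by nlinarith [sq_nonneg y]
        have h5 : y * (c - x) ≤ c := by
          rcases le_total 0 y with hy0 | hy0
          · exact (mul_le_of_le_one_left (by linarith) hy.2).trans (by linarith)
          · exact (mul_nonpos_of_nonpos_of_nonneg hy0 (by linarith)).trans hc0.le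
        have h6 : 8 * Real.pi * n₀ * (w₀ ^ 2 / 4) ≤ 8 * Real.pi * n₀ * (u ^ 2 + y ^ 2) := by
          gcongr
        refine le_trans ?_ h6
        calc 2 * Real.pi * y * (c - x) = 2 * Real.pi * (y * (c - x)) := by ring
          _ ≤ 2 * Real.pi * c := by gcongr
          _ = _ := by rw [hc]; ring
      linarith

lemma stationaryPhase_eq_mul (n₀ : ℕ) (w₀ L x : ℝ) (w : ℂ) :
    stationaryPhase n₀ w₀ L x w = stationaryPhase n₀ w₀ L 0 w * fourierExp (-(x / w)) := by
  have : fourierExp (-(((0 : ℝ) : ℂ) / w)) = 1 := by simp [fourierExp]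
  rw [stationaryPhase, stationaryPhase, this, mul_one]

lemma IsInversionSeries.hasSum_stationaryIntegral {j : ℕ} {f : ℂ → ℂ} {a : ℕ → ℂ}
    (h : IsInversionSeries j f a) (n₀ : ℕ) {w₀ : ℝ} (L : ℝ) (hw : 0 < w₀) :
    HasSum (fun m : ℕ => a m * stationaryIntegral n₀ j w₀ L m)
      (∫ u in w₀ / 2..3 * w₀ / 2, stationaryPhase n₀ w₀ L 0 (u + I) * f (u + I)) := by
  have hcont : ∀ x, Continuous fun u : ℝ => stationaryPhase n₀ w₀ L x (u + I) /
      ((u : ℂ) + I) ^ (2 * j) := fun x => by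
    have := continuous_stationaryPhase_div_line n₀ j w₀ L x one_ne_zero
    simpa only [ofReal_one, one_mul] using this
  obtain ⟨A, C₀, ha⟩ := h.coeff_bound
  obtain ⟨C, hC⟩ := isCompact_Icc.exists_bound_of_continuousOn
    (s := Set.Icc (w₀ / 2) (3 * w₀ / 2)) (hcont 0).continuousOn
  set y : ℝ := 2 * Real.pi / ((3 * w₀ / 2) ^ 2 + 1) with hy
  have hy0 : 0 < y := by positivity
  have hsum : Summable fun m : ℕ => C * (‖a m‖ * Real.exp (-(y * m))) :=
    (summable_norm_coeff_mul_exp ha hy0).mul_left C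
  have hle : w₀ / 2 ≤ 3 * w₀ / 2 := by linarith
  have key := intervalIntegral.hasSum_integral_of_dominated_convergence
    (μ := MeasureTheory.volume) (a := w₀ / 2) (b := 3 * w₀ / 2)
    (F := fun (m : ℕ) (u : ℝ) => a m * (stationaryPhase n₀ w₀ L m (u + I) / (u + I) ^ (2 * j)))
    (f := fun u : ℝ => stationaryPhase n₀ w₀ L 0 (u + I) * f (u + I))
    (fun m _ => C * (‖a m‖ * Real.exp (-(y * m))))
    (fun m => ((hcont m).const_mul _).aestronglyMeasurable)
    (fun m => Eventually.of_forall fun u hu => ?_)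
    (Eventually.of_forall fun _ _ => hsum) intervalIntegrable_const
    (Eventually.of_forall fun u hu => ?_)
  · simp only [intervalIntegral.integral_const_mul] at key
    exact key
  · rw [Set.uIoc_of_le hle] at hu
    have h1 := hC u ⟨hu.1.le, hu.2⟩
    have h2 : ‖fourierExp (-(((m : ℝ) : ℂ) / (u + I)))‖ ≤ Real.exp (-(y * m)) := by
      have h3 : (-(((m : ℝ) : ℂ) / ((u : ℂ) + I))).im = m / (u ^ 2 + 1) := by
        have : (u : ℂ) + I = u + (1 : ℝ) * I := by simp
        rw [this, neg_im, div_eq_mul_inv, im_ofReal_mul, inv_im, normSq_add_mul_I]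
        simp
        ring
      rw [norm_fourierExp, h3]
      apply Real.exp_le_exp.mpr (neg_le_neg _)
      have hu0 : 0 < u := by linarith [hu.1]
      have : 2 * Real.pi * (m / (u ^ 2 + 1)) = 2 * Real.pi / (u ^ 2 + 1) * m := by ring
      rw [this, hy]
      have := hu.2
      gcongr
    rw [stationaryPhase_eq_mul, mul_div_right_comm, norm_mul, norm_mul]
    calc _ ≤ ‖a m‖ * (C * Real.exp (-(y * m))) := by
          gcongr
          exact (norm_nonneg _).trans h1
      _ = _ := by ring
  · have him : 0 < ((u : ℂ) + I).im := by simp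
    have hne : (u : ℂ) + I ≠ 0 := fun h0 => by rw [h0] at him; simp at him
    have him' : 0 < (-1 / ((u : ℂ) + I)).im := by
      rw [im_neg_one_div]
      exact div_pos him (normSq_pos.mpr hne)
    have h1 := (h.hasSum _ him').mul_left
      (stationaryPhase n₀ w₀ L 0 (u + I) / ((u : ℂ) + I) ^ (2 * j))
    rw [h.inversion _ him, ← mul_assoc, div_mul_cancel₀ _ (pow_ne_zero _ hne)] at h1
    refine h1.congr_fun ?_ 
    intro m
    rw [stationaryPhase_eq_mul]
    have : (m : ℂ) * (-1 / (u + I)) = -(((m : ℝ) : ℂ) / (u + I)) := by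
      push_cast
      ring
    rw [this]
    ring

lemma HasSum.abel_Spart {a : ℕ → ℂ} (h0 : a 0 = 0) (ν : ℝ) {g : ℕ → ℂ} {s : ℂ}
    (hs : HasSum (fun m => a m * g m) s)
    (h1 : Summable fun n : ℕ => Spart a ν n * ((((n : ℝ) ^ ν : ℝ) : ℂ) * g n))
    (h2 : Summable fun n : ℕ => Spart a ν n * (((((n + 1 : ℕ) : ℝ) ^ ν : ℝ) : ℂ) * g (n + 1))) :
    HasSum (fun n : ℕ => Spart a ν n * ((((n : ℝ) ^ ν : ℝ) : ℂ) * g n -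
      ((((n + 1 : ℕ) : ℝ) ^ ν : ℝ) : ℂ) * g (n + 1))) s := by
  have hS0 : Spart a ν 0 = 0 := by
    rw [Spart_eq_sum_range h0]
    simp [h0]
  have hterm : ∀ n : ℕ, a (n + 1) * g (n + 1) =
      Spart a ν (n + 1) * (((((n + 1 : ℕ) : ℝ) ^ ν : ℝ) : ℂ) * g (n + 1)) -
      Spart a ν n * (((((n + 1 : ℕ) : ℝ) ^ ν : ℝ) : ℂ) * g (n + 1)) := fun n => by
    rw [Spart_eq_sum_range h0, Spart_eq_sum_range h0, Finset.sum_range_succ _ (n + 1)]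
    have : ((((n + 1 : ℕ) : ℝ) ^ (-ν) : ℝ) : ℂ) * ((((n + 1 : ℕ) : ℝ) ^ ν : ℝ) : ℂ) = 1 := by
      rw [← ofReal_mul, ← Real.rpow_add (by positivity)]
      simp
    linear_combination (-(a (n + 1) * g (n + 1))) * this
  have hs' := (hasSum_nat_add_iff' 1).mpr hs
  simp only [Finset.sum_range_one, h0, zero_mul, sub_zero] at hs'
  have h1' := (hasSum_nat_add_iff' 1).mpr h1.hasSum
  simp only [Finset.sum_range_one, hS0, zero_mul, sub_zero] at h1'
  have h3 := (h1'.sub h2.hasSum).congr_fun hterm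
  rw [hs'.unique h3]
  exact (h1.hasSum.sub h2.hasSum).congr_fun fun n => by ring

lemma integral_cexp_sq_mul_fourierExp {A : ℂ} (hA : 0 < A.re) (w₀ N : ℝ) :
    ∫ u : ℝ, cexp (-A * (u + I - w₀) ^ 2) * fourierExp (N * (u + I)) =
      (Real.pi / A) ^ (1 / 2 : ℂ) * (fourierExp (N * w₀) * cexp (-(Real.pi ^ 2 * N ^ 2 / A))) := by
  have hb : (-A).re < 0 := by simpa using hA
  have hA0 : A ≠ 0 := fun h => by simp [h] at hA
  have key := integral_cexp_quadratic hb (-2 * A * I + 2 * Real.pi * I * N)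
    (A + 2 * Real.pi * I * N * w₀ - 2 * Real.pi * N)
  have hshift := MeasureTheory.integral_sub_right_eq_self (μ := MeasureTheory.volume)
    (fun v : ℝ => cexp (-A * v ^ 2 + (-2 * A * I + 2 * Real.pi * I * N) * v +
      (A + 2 * Real.pi * I * N * w₀ - 2 * Real.pi * N))) w₀
  rw [key, neg_neg] at hshift
  refine Eq.trans (MeasureTheory.integral_congr_ae (Eventually.of_forall fun u => ?_))
    (hshift.trans ?_)
  · simp only [fourierExp]
    rw [← Complex.exp_add]
    congr 1
    push_cast
    linear_combination (-A + 2 * Real.pi * N) * I_sq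
  · congr 1
    rw [fourierExp, ← Complex.exp_add]
    congr 1
    field_simp
    linear_combination (4 * A ^ 2 - 8 * A * Real.pi * N + 4 * Real.pi ^ 2 * N ^ 2) * I_sq

lemma stationaryPhase_zero (n₀ : ℕ) (w₀ L : ℝ) (w : ℂ) :
    stationaryPhase n₀ w₀ L 0 w =
      cexp (-((1 / L ^ 2 : ℝ) - (2 * Real.pi * n₀ / w₀ : ℝ) * I) * (w - w₀) ^ 2) *
        fourierExp (-(n₀ * w)) := by
  simp [stationaryPhase, fourierExp]

lemma integrable_stationaryPhase_line (n₀ : ℕ) (w₀ : ℝ) {L : ℝ} (hL : 0 < L) :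
    MeasureTheory.Integrable fun u : ℝ => stationaryPhase n₀ w₀ L 0 (u + I) := by
  have hA : 0 < ((1 / L ^ 2 : ℝ) - (2 * Real.pi * n₀ / w₀ : ℝ) * I : ℂ).re := by
    rw [sub_re, ofReal_re, re_ofReal_mul, I_re, mul_zero, sub_zero]
    positivity
  by_contra hintegrable
  have h1 := integral_cexp_sq_mul_fourierExp hA w₀ (-(n₀ : ℝ))
  have h2 : (∫ u : ℝ, stationaryPhase n₀ w₀ L 0 (u + I)) = 0 := MeasureTheory.integral_undef hintegrable
  simp only [stationaryPhase_zero] at h2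
  push_cast at h1 h2
  simp only [neg_mul] at h1 h2
  rw [h2] at h1
  have hA0 : ((1 / L ^ 2 : ℝ) - (2 * Real.pi * n₀ / w₀ : ℝ) * I : ℂ) ≠ 0 :=
    fun h => by rw [h] at hA; simp at hA
  push_cast at hA0
  simp [fourierExp, Complex.exp_ne_zero, cpow_eq_zero_iff, Real.pi_ne_zero] at h1
  exact hA0 (by simpa using h1)

namespace IsInversionSeries

variable {j : ℕ} {f : ℂ → ℂ} {a : ℕ → ℂ}

lemma continuous_line (h : IsInversionSeries j f a) : Continuous fun u : ℝ => f (u + I) := by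
  obtain ⟨A, C, ha⟩ := h.coeff_bound
  have heq : (fun u : ℝ => f (u + I)) =
      fun u : ℝ => ∑' n : ℕ, a n * fourierExp (n * ((u : ℂ) + I)) := by
    funext u
    exact (h.hasSum _ (by simp)).tsum_eq.symm
  rw [heq]
  refine continuous_tsum (u := fun n : ℕ => ‖a n‖ * Real.exp (-(2 * Real.pi * n)))
    (fun n => ?_) (summable_norm_coeff_mul_exp ha (by positivity)) fun n u => ?_
  · exact continuous_const.mul (continuous_fourierExp.comp (by fun_prop))
  · rw [norm_coeff_mul_fourierExp]
    simp

lemma integrable_stationaryPhase_mul (h : IsInversionSeries j f a) (n₀ : ℕ) (w₀ : ℝ) {L : ℝ}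
    (hL : 0 < L) :
    MeasureTheory.Integrable fun u : ℝ => stationaryPhase n₀ w₀ L 0 (u + I) * f (u + I) := by
  obtain ⟨B, C, hC, hle⟩ := h.exists_norm_le
  refine (integrable_stationaryPhase_line n₀ w₀ hL).mul_bdd
    (c := C * Real.exp (-1)) h.continuous_line.aestronglyMeasurable
    (Eventually.of_forall fun u => ?_)
  have := hle ((u : ℂ) + I) (by simp)
  simpa using this

lemma hasSum_integral_stationaryPhase (h : IsInversionSeries j f a) (n₀ : ℕ) (w₀ : ℝ) {L : ℝ}
    (hL : 0 < L) {A : ℂ} (hA : A = (1 / L ^ 2 : ℝ) - (2 * Real.pi * n₀ / w₀ : ℝ) * I) :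
    HasSum (fun n : ℕ => a n * ((Real.pi / A) ^ (1 / 2 : ℂ) *
        (fourierExp (((n - n₀ : ℝ) : ℂ) * w₀) *
          cexp (-(Real.pi ^ 2 * ((n - n₀ : ℝ) : ℂ) ^ 2 / A)))))
      (∫ u : ℝ, stationaryPhase n₀ w₀ L 0 (u + I) * f (u + I)) := by
  have hA' : 0 < A.re := by
    rw [hA, sub_re, ofReal_re, re_ofReal_mul, I_re, mul_zero, sub_zero]
    positivity
  obtain ⟨B, C, ha⟩ := h.coeff_bound
  have key := MeasureTheory.hasSum_integral_of_summable_integral_norm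
    (μ := MeasureTheory.volume) (F := fun (n : ℕ) (u : ℝ) =>
      stationaryPhase n₀ w₀ L 0 (u + I) * (a n * fourierExp (n * ((u : ℂ) + I))))
    (fun n => ?_) ?_
  · have h1 : ∀ n : ℕ, (∫ u : ℝ, stationaryPhase n₀ w₀ L 0 (u + I) *
        (a n * fourierExp (n * ((u : ℂ) + I)))) = a n * ((Real.pi / A) ^ (1 / 2 : ℂ) *
        (fourierExp (((n - n₀ : ℝ) : ℂ) * w₀) *
          cexp (-(Real.pi ^ 2 * ((n - n₀ : ℝ) : ℂ) ^ 2 / A)))) := fun n => by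
      rw [← integral_cexp_sq_mul_fourierExp hA', ← MeasureTheory.integral_const_mul]
      congr 1
      funext u
      have : ((n - n₀ : ℝ) : ℂ) * (u + I) = -(n₀ * (u + I)) + n * (u + I) := by
        push_cast
        ring
      rw [stationaryPhase_zero, ← hA, this, fourierExp_add]
      ring
    have h2 := key.congr_fun fun n => (h1 n).symm
    have h3 : ∀ u : ℝ, stationaryPhase n₀ w₀ L 0 (u + I) * f (u + I) =
        ∑' n : ℕ, stationaryPhase n₀ w₀ L 0 (u + I) * (a n * fourierExp (n * ((u : ℂ) + I))) :=
      fun u => ((h.hasSum ((u : ℂ) + I) (by simp)).mul_left _).tsum_eq.symm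
    simp only [h3]
    exact h2
  · refine (integrable_stationaryPhase_line n₀ w₀ hL).mul_bdd
      (c := ‖a n‖ * Real.exp (-(2 * Real.pi * n)))
      (continuous_const.mul (continuous_fourierExp.comp (by fun_prop))).aestronglyMeasurable
      (Eventually.of_forall fun u => ?_)
    rw [norm_coeff_mul_fourierExp]
    simp
  · have h1 : ∀ n : ℕ, (∫ u : ℝ, ‖stationaryPhase n₀ w₀ L 0 (u + I) *
        (a n * fourierExp (n * ((u : ℂ) + I)))‖) =
        (∫ u : ℝ, ‖stationaryPhase n₀ w₀ L 0 (u + I)‖) *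
          (‖a n‖ * Real.exp (-(2 * Real.pi * n))) := fun n => by
      rw [← MeasureTheory.integral_mul_const]
      congr 1
      funext u
      rw [norm_mul, norm_coeff_mul_fourierExp]
      simp
    simp only [h1]
    exact (summable_norm_coeff_mul_exp ha (by positivity)).mul_left _

lemma exists_le_norm_integral_stationaryPhase (h : IsInversionSeries j f a) {n₀ : ℕ} (hn : 1 ≤ n₀)
    (han : a n₀ ≠ 0) :
    ∃ R : ℝ, ∀ w₀ L : ℝ, 0 < w₀ → 0 < L → 1 / L ^ 2 ≤ 2 * Real.pi * n₀ / w₀ →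
      R ≤ w₀ ^ 2 / (8 * n₀ ^ 2 * L ^ 2) →
      ‖a n₀‖ / 2 * √(w₀ / (4 * n₀)) ≤ ‖∫ u : ℝ, stationaryPhase n₀ w₀ L 0 (u + I) * f (u + I)‖ := by
  obtain ⟨B, C, ha⟩ := h.coeff_bound
  have hsumm := summable_norm_coeff_mul_exp ha one_pos
  set K := ∑' n : ℕ, ‖a n‖ * Real.exp (-(1 * n)) with hK
  obtain ⟨R, hR1, hR⟩ : ∃ R : ℝ, 1 ≤ R ∧ Real.exp (n₀ + 2) * K * Real.exp (-R) ≤ ‖a n₀‖ / 2 := by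
    have h1 : Tendsto (fun R : ℝ => Real.exp (n₀ + 2) * K * Real.exp (-R)) atTop
        (nhds (Real.exp (n₀ + 2) * K * 0)) :=
      (Real.tendsto_exp_neg_atTop_nhds_zero).const_mul _
    rw [mul_zero] at h1
    have h2 : 0 < ‖a n₀‖ / 2 := by positivity
    obtain ⟨R, hR, hR'⟩ := ((eventually_ge_atTop 1).and (h1.eventually_le_const h2)).exists
    exact ⟨R, hR, hR'⟩
  refine ⟨R, fun w₀ L hw hL hLb hRL => ?_⟩
  have hn0 : (0 : ℝ) < n₀ := by exact_mod_cast hn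
  set α : ℝ := 1 / L ^ 2 with hα
  set b : ℝ := 2 * Real.pi * n₀ / w₀ with hb
  have hα0 : 0 < α := by positivity
  have hb0 : 0 < b := by positivity
  set A : ℂ := (α : ℂ) - (b : ℝ) * I with hA
  have hs := h.hasSum_integral_stationaryPhase n₀ w₀ hL hA
  set P : ℂ := (Real.pi / A) ^ (1 / 2 : ℂ) with hP
  have hnormSq : normSq A = α ^ 2 + b ^ 2 := by
    rw [hA, normSq_apply]
    simp
    ring
  have hPnorm : √(w₀ / (4 * n₀)) ≤ ‖P‖ := by
    have h1 : (1 / 2 : ℂ) = ((1 / 2 : ℝ) : ℂ) := by push_cast; rfl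
    rw [hP, h1, Complex.norm_cpow_real, Real.sqrt_eq_rpow]
    gcongr
    rw [norm_div, norm_real, Real.norm_of_nonneg Real.pi_pos.le]
    have hA0 : 0 < ‖A‖ := by
      rw [norm_pos_iff, ← normSq_pos, hnormSq]
      positivity
    have h2 : ‖A‖ ≤ 4 * Real.pi * n₀ / w₀ := by
      refine (norm_sub_le _ _).trans ?_
      rw [norm_mul, norm_I, norm_real, norm_real, Real.norm_of_nonneg hα0.le,
        Real.norm_of_nonneg hb0.le]
      have : 4 * Real.pi * n₀ / w₀ = b + b := by rw [hb]; ring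
      linarith
    calc w₀ / (4 * n₀) = Real.pi / (4 * Real.pi * n₀ / w₀) := by field_simp
      _ ≤ _ := by gcongr
  have hre : R ≤ Real.pi ^ 2 * (A⁻¹).re := by
    have h1 : A.re = α := by simp [hA]
    rw [inv_re, hnormSq, h1]
    refine hRL.trans ?_
    calc w₀ ^ 2 / (8 * n₀ ^ 2 * L ^ 2) = Real.pi ^ 2 * (α / (b ^ 2 + b ^ 2)) := by
          rw [hα, hb]
          field_simp
          ring
      _ ≤ _ := by gcongr
  have hs' := hs.sub (hasSum_ite_eq n₀ (a n₀ * P))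
  have hmain : ‖(∫ u : ℝ, stationaryPhase n₀ w₀ L 0 (u + I) * f (u + I)) - a n₀ * P‖ ≤
      ‖P‖ * Real.exp (n₀ + 2) * Real.exp (-R) * K := by
    rw [← hs'.tsum_eq]
    refine tsum_of_norm_bounded (hsumm.hasSum.mul_left _) fun n => ?_
    split_ifs with hnn
    · subst hnn
      simp [fourierExp]
      positivity
    · have h1 : ‖fourierExp (((n - n₀ : ℝ) : ℂ) * w₀)‖ = 1 := by
        rw [norm_fourierExp, ← ofReal_mul, ofReal_im]
        simp
      have h2 : ‖cexp (-(Real.pi ^ 2 * ((n - n₀ : ℝ) : ℂ) ^ 2 / A))‖ =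
          Real.exp (-((n - n₀ : ℝ) ^ 2 * (Real.pi ^ 2 * (A⁻¹).re))) := by
        have : (-(Real.pi ^ 2 * ((n - n₀ : ℝ) : ℂ) ^ 2 / A) : ℂ) =
            ((-(Real.pi ^ 2 * (n - n₀ : ℝ) ^ 2) : ℝ) : ℂ) * A⁻¹ := by
          push_cast
          ring
        rw [Complex.norm_exp, this, re_ofReal_mul]
        congr 1
        ring
      have h3 : (1 : ℝ) ≤ (n - n₀ : ℝ) ^ 2 := by
        have : (1 : ℤ) ≤ ((n : ℤ) - n₀) ^ 2 := by
          have : (n : ℤ) - n₀ ≠ 0 := by omega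
          exact (one_le_sq_iff_one_le_abs _).mpr (Int.one_le_abs this)
        exact_mod_cast this
      rw [sub_zero, norm_mul, norm_mul, norm_mul, h1, h2, one_mul]
      have h4 : Real.exp (-((n - n₀ : ℝ) ^ 2 * (Real.pi ^ 2 * (A⁻¹).re))) ≤
          Real.exp (n₀ + 2) * Real.exp (-R) * Real.exp (-(1 * n)) := by
        rw [← Real.exp_add, ← Real.exp_add]
        apply Real.exp_le_exp.mpr
        have h5 : (n - n₀ : ℝ) ^ 2 * R ≤ (n - n₀ : ℝ) ^ 2 * (Real.pi ^ 2 * (A⁻¹).re) := by gcongr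
        nlinarith [sq_nonneg (n - n₀ - 1 : ℝ)]
      calc _ ≤ ‖a n‖ * (‖P‖ * (Real.exp (n₀ + 2) * Real.exp (-R) * Real.exp (-(1 * n)))) := by
            gcongr
        _ = _ := by ring
  have h1 : ‖a n₀ * P‖ ≤ ‖∫ u : ℝ, stationaryPhase n₀ w₀ L 0 (u + I) * f (u + I)‖ +
      ‖P‖ * Real.exp (n₀ + 2) * Real.exp (-R) * K := by
    have := norm_sub_norm_le (a n₀ * P) (∫ u : ℝ, stationaryPhase n₀ w₀ L 0 (u + I) * f (u + I))
    rw [norm_sub_rev] at this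
    linarith
  have h2 : ‖P‖ * Real.exp (n₀ + 2) * Real.exp (-R) * K ≤ ‖P‖ * (‖a n₀‖ / 2) := by
    calc _ = ‖P‖ * (Real.exp (n₀ + 2) * K * Real.exp (-R)) := by ring
      _ ≤ _ := by gcongr
  rw [norm_mul] at h1
  have h3 : ‖a n₀‖ / 2 * √(w₀ / (4 * n₀)) ≤ ‖a n₀‖ / 2 * ‖P‖ := by gcongr
  linarith

lemma exists_norm_integral_stationaryPhase_sub_le (h : IsInversionSeries j f a) (n₀ : ℕ) :
    ∃ C : ℝ, 0 < C ∧ ∀ w₀ L : ℝ, 0 < w₀ → 1 ≤ L → 16 * Real.pi * n₀ * L ^ 2 ≤ w₀ ^ 2 →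
      ‖(∫ u : ℝ, stationaryPhase n₀ w₀ L 0 (u + I) * f (u + I)) -
        ∫ u in w₀ / 2..3 * w₀ / 2, stationaryPhase n₀ w₀ L 0 (u + I) * f (u + I)‖ ≤
      C * (Real.exp (-(w₀ ^ 2 / (16 * L ^ 2))) * L) := by
  obtain ⟨B, C, hC, hle⟩ := h.exists_norm_le
  refine ⟨Real.exp (1 + 2 * Real.pi * n₀) * (C * Real.exp (-1)) * 4, by positivity,
    fun w₀ L hw hL hLw => ?_⟩
  have hL0 : 0 < L := by linarith
  have hintegrable := h.integrable_stationaryPhase_mul n₀ w₀ hL0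
  have hg : MeasureTheory.Integrable fun v : ℝ => Real.exp (-(1 / (4 * L ^ 2)) * v ^ 2) :=
    integrable_exp_neg_mul_sq (by positivity)
  set E := Real.exp (1 + 2 * Real.pi * n₀) * (C * Real.exp (-1)) *
    Real.exp (-(w₀ ^ 2 / (16 * L ^ 2))) with hE
  have hg' := (hg.comp_sub_right w₀).const_mul E
  rw [intervalIntegral.integral_of_le (by linarith),
    ← MeasureTheory.setIntegral_compl measurableSet_Ioc hintegrable]
  have hbound : ∀ u ∈ (Set.Ioc (w₀ / 2) (3 * w₀ / 2))ᶜ,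
      ‖stationaryPhase n₀ w₀ L 0 (u + I) * f (u + I)‖ ≤
        E * Real.exp (-(1 / (4 * L ^ 2)) * (u - w₀) ^ 2) := by
    intro u hu
    have h1 := hle ((u : ℂ) + I) (by simp)
    have h2 := norm_stationaryPhase n₀ w₀ L 0 u 1
    simp only [ofReal_one, one_mul, zero_mul] at h2
    have him : ((u : ℂ) + I).im = 1 := by simp
    rw [him, div_one, one_pow, mul_one] at h1
    have hv : (w₀ / 2) ^ 2 ≤ (u - w₀) ^ 2 := by
      rw [sq_le_sq, abs_of_pos (half_pos hw), le_abs]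
      by_contra! hcon
      exact hu ⟨by linarith [hcon.2], by linarith [hcon.1]⟩
    rw [norm_mul, h2]
    have h3 : Real.exp (-(((u - w₀) ^ 2 - 1 ^ 2) / L ^ 2) -
        2 * (2 * Real.pi * n₀ / w₀) * (u - w₀) * 1 + 2 * Real.pi * (n₀ * 1) -
        2 * Real.pi * (0 / (u ^ 2 + 1 ^ 2))) ≤
        Real.exp (1 + 2 * Real.pi * n₀) * Real.exp (-(w₀ ^ 2 / (16 * L ^ 2))) *
          Real.exp (-(1 / (4 * L ^ 2)) * (u - w₀) ^ 2) := by
      rw [← Real.exp_add, ← Real.exp_add]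
      apply Real.exp_le_exp.mpr
      set v := u - w₀ with hvdef
      have e1 : (v ^ 2 - 1 ^ 2) / L ^ 2 = v ^ 2 / L ^ 2 - 1 / L ^ 2 := by ring
      have e2 : 1 / L ^ 2 ≤ 1 := by
        rw [div_le_one (by positivity)]
        exact one_le_pow₀ hL
      have e3 : w₀ ^ 2 / (16 * L ^ 2) ≤ v ^ 2 / L ^ 2 / 4 := by
        have : w₀ ^ 2 / (16 * L ^ 2) = (w₀ / 2) ^ 2 / L ^ 2 / 4 := by field_simp; norm_num
        rw [this]
        gcongr
      have e4 : 1 / (4 * L ^ 2) * v ^ 2 = v ^ 2 / L ^ 2 / 4 := by field_simp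
      have e5 : -(2 * (2 * Real.pi * n₀ / w₀) * v * 1) ≤ v ^ 2 / L ^ 2 / 2 := by
        have g1 : w₀ * -v ≤ 2 * v ^ 2 := by
          have g2 : w₀ / 2 ≤ |v| := by
            rwa [← abs_of_pos (half_pos hw), ← sq_le_sq]
          have g3 := neg_le_abs v
          have g4 : w₀ * -v ≤ w₀ * |v| := by gcongr
          have g5 : w₀ * |v| ≤ 2 * |v| * |v| := by gcongr; linarith
          have g6 : |v| * |v| = v ^ 2 := by rw [← sq, sq_abs]
          linarith
        calc -(2 * (2 * Real.pi * n₀ / w₀) * v * 1) =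
              4 * Real.pi * n₀ / w₀ ^ 2 * (w₀ * -v) := by field_simp; ring
          _ ≤ 4 * Real.pi * n₀ / w₀ ^ 2 * (2 * v ^ 2) := by gcongr
          _ = 16 * Real.pi * n₀ * L ^ 2 * (v ^ 2 / (2 * L ^ 2 * w₀ ^ 2)) := by field_simp; ring
          _ ≤ w₀ ^ 2 * (v ^ 2 / (2 * L ^ 2 * w₀ ^ 2)) := by gcongr
          _ = _ := by field_simp
      rw [e1, neg_mul, e4, zero_div]
      linarith
    calc _ ≤ (Real.exp (1 + 2 * Real.pi * n₀) * Real.exp (-(w₀ ^ 2 / (16 * L ^ 2))) *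
          Real.exp (-(1 / (4 * L ^ 2)) * (u - w₀) ^ 2)) * (C * Real.exp (-1)) :=
          mul_le_mul h3 h1 (norm_nonneg _) (by positivity)
      _ = _ := by rw [hE]; ring
  calc _ ≤ ∫ u in (Set.Ioc (w₀ / 2) (3 * w₀ / 2))ᶜ,
        E * Real.exp (-(1 / (4 * L ^ 2)) * (u - w₀) ^ 2) :=
        MeasureTheory.norm_integral_le_of_norm_le hg'.integrableOn
          ((MeasureTheory.ae_restrict_iff' measurableSet_Ioc.compl).mpr
            (Eventually.of_forall hbound))
    _ ≤ ∫ u : ℝ, E * Real.exp (-(1 / (4 * L ^ 2)) * (u - w₀) ^ 2) :=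
        MeasureTheory.setIntegral_le_integral hg' (Eventually.of_forall fun u => by positivity)
    _ = E * √(Real.pi / (1 / (4 * L ^ 2))) := by
        rw [MeasureTheory.integral_const_mul, MeasureTheory.integral_sub_right_eq_self
          (fun u : ℝ => Real.exp (-(1 / (4 * L ^ 2)) * u ^ 2)), integral_gaussian]
    _ ≤ E * √((4 * L) ^ 2) := by
        gcongr
        rw [div_div_eq_mul_div, div_one]
        nlinarith [Real.pi_lt_d2, mul_pos hL0 hL0]
    _ = _ := by
        rw [Real.sqrt_sq (by positivity), hE]
        ring

end IsInversionSeries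

lemma norm_le_of_hasSum_mul_of_window {S D : ℕ → ℂ} {s : ℂ} (hs : HasSum (fun n => S n * D n) s)
    (Z : Finset ℕ) {δ : ℝ} {g : ℕ → ℝ} (hg : Summable g) (hg0 : ∀ n, 0 ≤ g n)
    (hZ : ∀ n ∈ Z, ‖D n‖ ≤ δ) (hZ' : ∀ n ∉ Z, ‖S n * D n‖ ≤ g n) :
    ‖s‖ ≤ δ * ∑ n ∈ Z, ‖S n‖ + ∑' n, g n := by
  have h1 : HasSum (fun n => if n ∈ Z then δ * ‖S n‖ else 0)
      (∑ n ∈ Z, if n ∈ Z then δ * ‖S n‖ else 0) :=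
    hasSum_sum_of_ne_finset_zero fun n hn => by simp [hn]
  rw [Finset.sum_congr rfl fun n hn => if_pos hn, ← Finset.mul_sum] at h1
  rw [← hs.tsum_eq]
  refine tsum_of_norm_bounded (h1.add hg.hasSum) fun n => ?_
  split_ifs with hn
  · rw [norm_mul, mul_comm]
    have := mul_le_mul_of_nonneg_right (hZ n hn) (norm_nonneg (S n))
    linarith [hg0 n]
  · rw [zero_add]
    exact hZ' n hn

lemma succ_rpow_sub_rpow_le {ν : ℝ} (hν : 0 ≤ ν) {n : ℝ} (hn : 1 ≤ n) :
    (n + 1) ^ ν - n ^ ν ≤ n ^ ν * (ν * Real.exp ν / n) := by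
  have hn0 : 0 < n := by linarith
  have h1 : (n + 1) ^ ν = n ^ ν * (1 + 1 / n) ^ ν := by
    rw [← Real.mul_rpow hn0.le (by positivity)]
    congr 1
    field_simp
  have h2 : (1 + 1 / n) ^ ν ≤ Real.exp (ν / n) := by
    calc (1 + 1 / n) ^ ν ≤ Real.exp (1 / n) ^ ν := by
          gcongr
          linarith [Real.add_one_le_exp (1 / n)]
      _ = Real.exp (ν / n) := by
          rw [← Real.exp_mul]
          congr 1
          ring
  have h3 : Real.exp (ν / n) - 1 ≤ ν / n * Real.exp (ν / n) := by
    have h4 := Real.add_one_le_exp (-(ν / n))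
    have h5 : Real.exp (-(ν / n)) * Real.exp (ν / n) = 1 := by
      rw [← Real.exp_add]
      simp
    have h6 := mul_le_mul_of_nonneg_right h4 (Real.exp_pos (ν / n)).le
    linarith
  have h4 : Real.exp (ν / n) ≤ Real.exp ν := Real.exp_le_exp.mpr (div_le_self hν hn)
  have h5 : ν / n * Real.exp (ν / n) ≤ ν * Real.exp ν / n := by
    rw [div_mul_eq_mul_div]
    gcongr
  have h6 : n ^ ν * ((1 + 1 / n) ^ ν - 1) ≤ n ^ ν * (ν * Real.exp ν / n) := by
    gcongr
    linarith
  linarith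

noncomputable def weightedIntegralDiff (ν : ℝ) (n₀ j : ℕ) (w₀ L : ℝ) (n : ℕ) : ℂ :=
  (((n : ℝ) ^ ν : ℝ) : ℂ) * stationaryIntegral n₀ j w₀ L n -
    ((((n + 1 : ℕ) : ℝ) ^ ν : ℝ) : ℂ) * stationaryIntegral n₀ j w₀ L ((n + 1 : ℕ) : ℝ)

lemma norm_weightedIntegralDiff_le {ν : ℝ} (hν : 0 ≤ ν) {n₀ n : ℕ} (hn₀ : 1 ≤ n₀) (j : ℕ)
    {w₀ L H : ℝ} (hw : 16 ≤ w₀) (hL : 1 ≤ L) (hLw : 64 * Real.pi * n₀ * L ^ 3 ≤ w₀ ^ 2)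
    (hH : 8 * Real.pi * (H + 1) ≤ w₀ ^ 2) (hn : |n - n₀ * w₀ ^ 2| ≤ H) :
    ‖weightedIntegralDiff ν n₀ j w₀ L n‖ ≤
      2 ^ ν * (3 * Real.exp 3 * (14 + ν * Real.exp ν)) *
        ((n₀ * w₀ ^ 2) ^ ν * (2 / w₀) ^ (2 * j + 1) * L) := by
  have hw0 : 0 < w₀ := by linarith
  have hpi := Real.pi_gt_three
  have hn1 : (1 : ℝ) ≤ n₀ := by exact_mod_cast hn₀
  set c : ℝ := n₀ * w₀ ^ 2 with hc
  have hcw : w₀ ^ 2 ≤ c := le_mul_of_one_le_left (by positivity) hn1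
  have hH0 : 0 ≤ H := (abs_nonneg _).trans hn
  have hHc : H ≤ c / 2 := by nlinarith
  have hn' := abs_le.mp hn
  have hnc : c / 2 ≤ n := by linarith [hn'.1]
  have hnc' : (n : ℝ) ≤ 2 * c := by linarith [hn'.2]
  have hnw : w₀ / 2 ≤ n := by nlinarith
  have hn1' : (1 : ℝ) ≤ n := by linarith
  have hninv : 1 / (n : ℝ) ≤ 2 / w₀ := by
    rw [div_le_div_iff₀ (by linarith) hw0]
    linarith
  have h1 := norm_stationaryIntegral_sub_le (x := n) j hw hL hLw
    ((mul_le_mul_of_nonneg_left (hn.trans (by linarith)) (by positivity)).trans hH)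
  have h2 : ‖stationaryIntegral n₀ j w₀ L (n + 1)‖ ≤ _ := norm_stationaryIntegral_le j hw0 hL hLw <| by
    refine le_trans ?_ hH
    gcongr
    have : (n : ℝ) + 1 - n₀ * w₀ ^ 2 = (n - n₀ * w₀ ^ 2) + 1 := by ring
    rw [this]
    exact (abs_add_le _ _).trans (by rw [abs_one]; linarith)
  have heq : weightedIntegralDiff ν n₀ j w₀ L n =
      (((n : ℝ) ^ ν : ℝ) : ℂ) *
        (stationaryIntegral n₀ j w₀ L n - stationaryIntegral n₀ j w₀ L (n + 1)) -
      ((((n : ℝ) + 1) ^ ν - (n : ℝ) ^ ν : ℝ) : ℂ) * stationaryIntegral n₀ j w₀ L (n + 1) := by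
    rw [weightedIntegralDiff]
    push_cast
    ring
  have hdiff0 : 0 ≤ ((n : ℝ) + 1) ^ ν - (n : ℝ) ^ ν := by
    rw [sub_nonneg]
    gcongr
    linarith
  have hdiff := succ_rpow_sub_rpow_le hν hn1'
  have hpow : (n : ℝ) ^ ν ≤ 2 ^ ν * c ^ ν := by
    rw [← Real.mul_rpow (by norm_num) (by positivity)]
    gcongr
  rw [heq]
  refine (norm_sub_le _ _).trans ?_
  rw [norm_mul, norm_mul, norm_real, norm_real, Real.norm_of_nonneg hdiff0,
    Real.norm_of_nonneg (by positivity)]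
  calc _ ≤ (n : ℝ) ^ ν * ((2 / w₀) ^ (2 * j + 1) * (14 * Real.exp 3) * (3 * L)) +
        ((n : ℝ) ^ ν * (ν * Real.exp ν / n)) * ((2 / w₀) ^ (2 * j) * Real.exp 3 * (3 * L)) := by
        gcongr
    _ = (n : ℝ) ^ ν * ((2 / w₀) ^ (2 * j) * Real.exp 3 * (3 * L) *
          (14 * (2 / w₀) + ν * Real.exp ν * (1 / n))) := by ring
    _ ≤ (2 ^ ν * c ^ ν) * ((2 / w₀) ^ (2 * j) * Real.exp 3 * (3 * L) *
          (14 * (2 / w₀) + ν * Real.exp ν * (2 / w₀))) := by gcongr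
    _ = _ := by ring

lemma exists_tsum_succ_pow_mul_exp_neg_div_le (B : ℕ) :
    ∃ C : ℝ, 0 < C ∧ ∀ c : ℝ, 1 ≤ c →
      Summable (fun n : ℕ => ((n : ℝ) + 1) ^ B * Real.exp (-(n / c))) ∧
      ∑' n : ℕ, ((n : ℝ) + 1) ^ B * Real.exp (-(n / c)) ≤ C * c ^ (B + 1) := by
  obtain ⟨C, hC, hle⟩ := tsum_pow_mul_exp_neg_le B
  refine ⟨Real.exp 1 * (C * Real.exp 1), by positivity, fun c hc => ?_⟩
  have hc0 : 0 < c := by linarith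
  have hy : 0 < 1 / c := by positivity
  have hinv : 1 / c ≤ 1 := (div_le_one hc0).mpr hc
  have hs := summable_pow_mul_exp_neg B hy
  have heq : (fun n : ℕ => ((n : ℝ) + 1) ^ B * Real.exp (-(n / c))) =
      fun n : ℕ => Real.exp (1 / c) *
        (((n + 1 : ℕ) : ℝ) ^ B * Real.exp (-(1 / c * (n + 1 : ℕ)))) := by
    funext n
    have : Real.exp (-(n / c)) = Real.exp (1 / c) * Real.exp (-(1 / c * (n + 1 : ℕ))) := by
      rw [← Real.exp_add]
      congr 1
      push_cast
      ring
    rw [this]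
    push_cast
    ring
  have hs' := (summable_nat_add_iff 1).mpr hs
  rw [heq]
  refine ⟨hs'.mul_left _, ?_⟩
  rw [tsum_mul_left]
  have h1 : ∑' n : ℕ, ((n + 1 : ℕ) : ℝ) ^ B * Real.exp (-(1 / c * (n + 1 : ℕ))) ≤
      ∑' n : ℕ, (n : ℝ) ^ B * Real.exp (-(1 / c * n)) := by
    rw [hs.tsum_eq_zero_add]
    have : (0 : ℝ) ≤ ((0 : ℕ) : ℝ) ^ B * Real.exp (-(1 / c * (0 : ℕ))) := by positivity
    linarith
  calc _ ≤ Real.exp 1 * (C * (1 / (1 / c)) ^ (B + 1) * Real.exp 1) := by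
        gcongr
        refine h1.trans ((hle _ hy).trans ?_)
        gcongr
    _ = _ := by
        rw [one_div_one_div]
        ring

noncomputable def nearIndices (c H : ℝ) : Finset ℕ :=
  {n ∈ Finset.range (⌊2 * c⌋₊ + 1) | |(n : ℝ) - c| ≤ H}

lemma mem_nearIndices {c H : ℝ} (hH : H ≤ c) {n : ℕ} :
    n ∈ nearIndices c H ↔ |(n : ℝ) - c| ≤ H := by
  simp only [nearIndices, Finset.mem_filter, Finset.mem_range, and_iff_right_iff_imp]
  intro h
  rw [Nat.lt_succ_iff]
  exact Nat.le_floor (by linarith [(abs_le.mp h).2])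

namespace IsInversionSeries

variable {j : ℕ} {f : ℂ → ℂ} {a : ℕ → ℂ}

lemma hasSum_Spart_mul_weightedIntegralDiff (h : IsInversionSeries j f a) {ν : ℝ}
    (n₀ : ℕ) {w₀ L : ℝ} (hw : 0 < w₀) {g : ℕ → ℝ} (hg : Summable g) {N : ℕ}
    (h1 : ∀ n, N ≤ n → ‖Spart a ν n‖ * ((n : ℝ) ^ ν * ‖stationaryIntegral n₀ j w₀ L n‖) ≤ g n)
    (h2 : ∀ n, N ≤ n → ‖Spart a ν n‖ * (((n + 1 : ℕ) : ℝ) ^ ν *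
      ‖stationaryIntegral n₀ j w₀ L ((n + 1 : ℕ) : ℝ)‖) ≤ g n) :
    HasSum (fun n : ℕ => Spart a ν n * weightedIntegralDiff ν n₀ j w₀ L n)
      (∫ u in w₀ / 2..3 * w₀ / 2, stationaryPhase n₀ w₀ L 0 (u + I) * f (u + I)) := by
  refine HasSum.abel_Spart h.coeff_zero ν (g := fun n => stationaryIntegral n₀ j w₀ L n)
    (h.hasSum_stationaryIntegral n₀ L hw) ?_ ?_
  · refine Summable.of_norm_bounded_eventually_nat hg ?_
    filter_upwards [eventually_ge_atTop N] with n hn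
    rw [norm_mul, norm_mul, norm_real, Real.norm_of_nonneg (by positivity)]
    exact h1 n hn
  · refine Summable.of_norm_bounded_eventually_nat hg ?_
    filter_upwards [eventually_ge_atTop N] with n hn
    rw [norm_mul, norm_mul, norm_real, Real.norm_of_nonneg (by positivity)]
    exact h2 n hn

lemma exists_norm_window_integral_le (h : IsInversionSeries j f a) {n₀ : ℕ} (hn₀ : 1 ≤ n₀) {ν : ℝ}
    (hν : 0 ≤ ν) :
    ∃ (C : ℝ) (B : ℕ), 0 < C ∧ ∀ w₀ L H M : ℝ, 16 ≤ w₀ → 2 ≤ L →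
      64 * Real.pi * n₀ * L ^ 3 ≤ w₀ ^ 2 → 2 ≤ H → 8 * Real.pi * (H + 1) ≤ w₀ ^ 2 →
      M ≤ w₀ ^ 2 / (8 * L ^ 2) → M ≤ L * (H / 2) / (2 * w₀ ^ 2) →
      ‖∫ u in w₀ / 2..3 * w₀ / 2, stationaryPhase n₀ w₀ L 0 (u + I) * f (u + I)‖ ≤
        C * ((n₀ * w₀ ^ 2) ^ ν * (2 / w₀) ^ (2 * j + 1) * L) *
          ∑ n ∈ nearIndices (n₀ * w₀ ^ 2) H, ‖Spart a ν n‖ +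
        C * (w₀ * Real.exp (-M) * (n₀ * w₀ ^ 2) ^ B) := by
  obtain ⟨A, C₀, ha⟩ := h.coeff_bound
  have hC₀ : 0 ≤ C₀ := by simpa using (norm_nonneg _).trans (ha 1)
  obtain ⟨N, hN⟩ := exists_nat_ge ν
  obtain ⟨C₁, hC₁, hsum⟩ := exists_tsum_succ_pow_mul_exp_neg_div_le (A + 1 + N)
  set K : ℝ := 10 * Real.exp (3 + 8 * Real.pi * n₀) * C₀ with hK
  refine ⟨2 ^ ν * (3 * Real.exp 3 * (14 + ν * Real.exp ν)) + K * C₁, A + 1 + N + 1, by positivity,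
    fun w₀ L H M hw hL hLw hH hHw hM hM' => ?_⟩
  have hw0 : 0 < w₀ := by linarith
  have hpi := Real.pi_gt_three
  have hn1 : (1 : ℝ) ≤ n₀ := by exact_mod_cast hn₀
  set c : ℝ := n₀ * w₀ ^ 2 with hc
  have hcw : w₀ ^ 2 ≤ c := le_mul_of_one_le_left (by positivity) hn1
  have hc1 : 1 ≤ c := by nlinarith
  have hc0 : 0 < c := by linarith
  have hHc : H ≤ c := by nlinarith
  obtain ⟨hg, hgle⟩ := hsum c hc1
  set q : ℝ := K / 2 * w₀ * Real.exp (-M) with hq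
  have hq0 : 0 ≤ q := by positivity
  have hSI : ∀ x : ℝ, 0 ≤ x → H / 2 ≤ |x - c| → ‖stationaryIntegral n₀ j w₀ L x‖ ≤
      5 * Real.exp (3 + 8 * Real.pi * n₀) * w₀ * Real.exp (-M) * Real.exp (-(x / c)) := by
    intro x hx hxT
    refine (norm_stationaryIntegral_le_tail j hn₀ (by linarith) hL hLw hM hM' hx (by linarith)
      hxT).trans_eq ?_
    rw [← hc, sub_eq_add_neg _ (x / c), sub_eq_add_neg _ M, Real.exp_add, Real.exp_add]
    ring
  have hterm : ∀ (n : ℕ) (x : ℝ), (n : ℝ) ≤ x → 0 < x → x ≤ n + 1 → H / 2 ≤ |x - c| →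
      ‖Spart a ν n‖ * (x ^ ν * ‖stationaryIntegral n₀ j w₀ L x‖) ≤
        q * (((n : ℝ) + 1) ^ (A + 1 + N) * Real.exp (-(n / c))) := by
    intro n x hnx hx hxn hxT
    have h1 := exists_norm_Spart_le h.coeff_zero ha hν n
    have h2 := hSI x hx.le hxT
    have h3 : x ^ ν ≤ ((n : ℝ) + 1) ^ N := by
      calc x ^ ν ≤ ((n : ℝ) + 1) ^ ν := by gcongr
        _ ≤ ((n : ℝ) + 1) ^ (N : ℝ) := by
            gcongr
            linarith [Nat.cast_nonneg (α := ℝ) n]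
        _ = _ := Real.rpow_natCast _ _
    have h4 : Real.exp (-(x / c)) ≤ Real.exp (-(n / c)) := by gcongr
    calc _ ≤ (C₀ * ((n : ℝ) + 1) ^ (A + 1)) * (((n : ℝ) + 1) ^ N *
          (5 * Real.exp (3 + 8 * Real.pi * n₀) * w₀ * Real.exp (-M) * Real.exp (-(n / c)))) := by
          gcongr
          · refine h1.trans ?_
            gcongr
            linarith
          · exact h2.trans (by gcongr)
      _ = _ := by
          rw [hq, hK, pow_add _ (A + 1)]
          ring
  have hS0 : Spart a ν 0 = 0 := by
    rw [Spart_eq_sum_range h.coeff_zero]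
    simp [h.coeff_zero]
  have hfar : ∀ n : ℕ, H ≤ |(n : ℝ) - c| →
      ‖Spart a ν n‖ * ((n : ℝ) ^ ν * ‖stationaryIntegral n₀ j w₀ L n‖) ≤
        q * (((n : ℝ) + 1) ^ (A + 1 + N) * Real.exp (-(n / c))) ∧
      ‖Spart a ν n‖ * (((n + 1 : ℕ) : ℝ) ^ ν *
        ‖stationaryIntegral n₀ j w₀ L ((n + 1 : ℕ) : ℝ)‖) ≤
        q * (((n : ℝ) + 1) ^ (A + 1 + N) * Real.exp (-(n / c))) := by
    intro n hn
    constructor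
    · rcases Nat.eq_zero_or_pos n with rfl | hn0
      · rw [hS0, norm_zero, zero_mul]
        positivity
      · exact hterm n n le_rfl (by exact_mod_cast hn0) (by linarith) (by linarith)
    · refine hterm n _ (by push_cast; linarith) (by positivity) (by push_cast; linarith) ?_
      have : (n : ℝ) - c = (((n + 1 : ℕ) : ℝ) - c) - 1 := by push_cast; ring
      have h1 := abs_sub (((n + 1 : ℕ) : ℝ) - c) 1
      rw [← this, abs_one] at h1
      linarith
  have hlarge : ∀ n : ℕ, ⌈c + H⌉₊ ≤ n → H ≤ |(n : ℝ) - c| := fun n hn => by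
    have := (Nat.le_ceil (c + H)).trans (Nat.cast_le.mpr hn)
    exact (by linarith : H ≤ (n : ℝ) - c).trans (le_abs_self _)
  have hs := h.hasSum_Spart_mul_weightedIntegralDiff n₀ (L := L) hw0 (hg.mul_left q)
    (fun n hn => (hfar n (hlarge n hn)).1) (fun n hn => (hfar n (hlarge n hn)).2)
  have key := norm_le_of_hasSum_mul_of_window hs (nearIndices c H) (hg.mul_left (2 * q))
    (fun n => by positivity)
    (fun n hn => norm_weightedIntegralDiff_le hν hn₀ j hw (by linarith) hLw hHw
      ((mem_nearIndices hHc).mp hn))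
    (fun n hn => ?_)
  · rw [tsum_mul_left] at key
    refine key.trans (add_le_add ?_ ?_)
    · gcongr
      exact le_add_of_nonneg_right (by positivity)
    · calc _ ≤ 2 * q * (C₁ * c ^ (A + 1 + N + 1)) := by gcongr
        _ = K * C₁ * (w₀ * Real.exp (-M) * c ^ (A + 1 + N + 1)) := by
            rw [hq]
            ring
        _ ≤ _ := by
            gcongr
            exact le_add_of_nonneg_left (by positivity)
  · rw [mem_nearIndices hHc, not_le] at hn
    obtain ⟨h1, h2⟩ := hfar n hn.le
    rw [norm_mul, weightedIntegralDiff]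
    have h3 := norm_sub_le ((((n : ℝ) ^ ν : ℝ) : ℂ) * stationaryIntegral n₀ j w₀ L n)
      (((((n + 1 : ℕ) : ℝ) ^ ν : ℝ) : ℂ) * stationaryIntegral n₀ j w₀ L ((n + 1 : ℕ) : ℝ))
    rw [norm_mul, norm_mul, norm_real, norm_real, Real.norm_of_nonneg (by positivity),
      Real.norm_of_nonneg (by positivity)] at h3
    have h4 := mul_le_mul_of_nonneg_left h3 (norm_nonneg (Spart a ν n))
    linarith

end IsInversionSeries

lemma eventually_const_mul_rpow_le_rpow (K : ℝ) {p q : ℝ} (hpq : p < q) :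
    ∀ᶠ c : ℝ in atTop, K * c ^ p ≤ c ^ q := by
  filter_upwards [(tendsto_rpow_atTop (sub_pos.mpr hpq)).eventually_ge_atTop K,
    eventually_gt_atTop 0] with c hc hc0
  calc K * c ^ p ≤ c ^ (q - p) * c ^ p := by gcongr
    _ = c ^ q := by
      rw [← Real.rpow_add hc0]
      congr 1
      ring

namespace IsInversionSeries

variable {j : ℕ} {f : ℂ → ℂ} {a : ℕ → ℂ}

set_option maxHeartbeats 1000000 in
lemma exists_rpow_quarter_le (h : IsInversionSeries j f a) {n₀ : ℕ} (hn₀ : 1 ≤ n₀)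
    (han : a n₀ ≠ 0) {ν : ℝ} (hν : 0 ≤ ν) {d : ℝ} (hd : 0 < d) (hd' : d ≤ 1 / 48) :
    ∃ C : ℝ, 0 < C ∧ ∀ᶠ c : ℝ in atTop,
      c ^ (1 / 4 : ℝ) ≤ C * (c ^ (ν - j - 1 / 2 + (1 / 3 - d)) *
        ∑ n ∈ nearIndices c (c ^ (2 / 3 + 2 * d)), ‖Spart a ν n‖) + C := by
  obtain ⟨C₁, B, hC₁, hwin⟩ := h.exists_norm_window_integral_le hn₀ hν
  obtain ⟨C₂, hC₂, hdiff⟩ := h.exists_norm_integral_stationaryPhase_sub_le n₀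
  obtain ⟨R, hmain⟩ := h.exists_le_norm_integral_stationaryPhase hn₀ han
  have hn1 : (1 : ℝ) ≤ n₀ := by exact_mod_cast hn₀
  have hn0 : (0 : ℝ) < n₀ := by linarith
  have hpi := Real.pi_gt_three
  set k : ℝ := ‖a n₀‖ / 2 * √(1 / (4 * n₀ * √n₀)) with hk
  have hk0 : 0 < k := by positivity
  set C₃ : ℝ := C₁ * (2 * √n₀) ^ (2 * j + 1) with hC₃
  have hC₃0 : 0 < C₃ := by positivity
  refine ⟨(C₃ + 2) / k, by positivity, ?_⟩
  filter_upwards [eventually_ge_atTop (256 * (n₀ : ℝ)),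
    (tendsto_rpow_atTop (by linarith : 0 < 1 / 3 - d)).eventually_ge_atTop 2,
    (tendsto_rpow_atTop (by linarith : 0 < 2 / 3 + 2 * d)).eventually_ge_atTop 2,
    eventually_const_mul_rpow_le_rpow (64 * Real.pi * n₀ ^ 2)
      (by linarith : (1 / 3 - d) * (3 : ℕ) < 1),
    eventually_const_mul_rpow_le_rpow (16 * Real.pi * n₀) (by linarith : 2 / 3 + 2 * d < 1),
    (tendsto_rpow_atTop (by linarith : 0 < 1 / 3 + 2 * d)).eventually_ge_atTop (R * (8 * n₀ ^ 3)),
    eventually_rpow_mul_exp_neg_rpow_le (B + 1) (by positivity : 0 < 1 / (8 * (n₀ : ℝ))) hd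
      (by positivity : 0 < 1 / C₁),
    eventually_rpow_mul_exp_neg_rpow_le (1 / 3 - d) (by positivity : 0 < 1 / (16 * (n₀ : ℝ)))
      (by linarith : 0 < 1 / 3 + 2 * d) (by positivity : 0 < 1 / C₂)]
    with c hc1 hL hH hL3 hHc hR htail htail'
  have hc : 1 ≤ c := by linarith
  have hc0 : 0 < c := by linarith
  set L := c ^ (1 / 3 - d) with hLdef
  set H := c ^ (2 / 3 + 2 * d) with hHdef
  set w₀ := √(c / n₀) with hw₀
  have hw2 : w₀ ^ 2 = c / n₀ := Real.sq_sqrt (by positivity)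
  have hcw : n₀ * w₀ ^ 2 = c := by
    rw [hw2]
    field_simp
  have hw16 : 16 ≤ w₀ := by
    apply Real.le_sqrt_of_sq_le
    rw [le_div_iff₀ hn0]
    linarith
  have hw0 : 0 < w₀ := by linarith
  have hL0 : 0 < L := by linarith
  have hH0 : 0 < H := by linarith
  have hwc : w₀ ≤ c ^ (1 / 2 : ℝ) := by
    rw [← Real.sqrt_eq_rpow]
    apply Real.sqrt_le_sqrt
    exact div_le_self hc0.le hn1
  rw [Real.rpow_mul_natCast hc0.le, Real.rpow_one, ← hLdef] at hL3
  rw [Real.rpow_one] at hHc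
  have hLw : 64 * Real.pi * n₀ * L ^ 3 ≤ w₀ ^ 2 := by
    rw [hw2, le_div_iff₀ hn0]
    linarith
  have hL2 : L ^ 2 = c ^ (2 / 3 - 2 * d) := by
    rw [hLdef, ← Real.rpow_mul_natCast hc0.le]
    congr 1
    push_cast
    ring
  have hcL : c / L ^ 2 = c ^ (1 / 3 + 2 * d) := by
    rw [hL2]
    nth_rewrite 1 [← Real.rpow_one c]
    rw [← Real.rpow_sub hc0]
    congr 1
    ring
  have hLH : L * H = c ^ d * c := by
    rw [hLdef, hHdef, ← Real.rpow_add hc0, ← Real.rpow_add_one hc0.ne']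
    congr 1
    ring
  have hwin' := hwin w₀ L H (1 / (8 * n₀) * c ^ d) hw16 hL hLw hH (by
      rw [hw2, le_div_iff₀ hn0]
      nlinarith [mul_pos Real.pi_pos hn0]) (by
      have : w₀ ^ 2 / (8 * L ^ 2) = 1 / (8 * n₀) * (c / L ^ 2) := by
        rw [hw2]
        field_simp
      rw [this, hcL]
      gcongr
      linarith) (by
      have : L * (H / 2) / (2 * w₀ ^ 2) = n₀ / 4 * c ^ d := by
        rw [hw2]
        field_simp
        rw [hLH]
        ring
      rw [this]
      have : 1 / (8 * (n₀ : ℝ)) ≤ n₀ / 4 := by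
        rw [div_le_div_iff₀ (by positivity) (by norm_num)]
        nlinarith
      gcongr)
  have hdiff' := hdiff w₀ L hw0 (by linarith) (by
    refine le_trans ?_ hLw
    have : L ^ 2 ≤ L ^ 3 := pow_le_pow_right₀ (by linarith) (by norm_num)
    gcongr
    norm_num)
  have hmain' := hmain w₀ L hw0 hL0 (by
    rw [div_le_div_iff₀ (by positivity) hw0, one_mul, hL2]
    have h1 : c ^ (1 / 2 : ℝ) ≤ c ^ (2 / 3 - 2 * d) :=
      Real.rpow_le_rpow_of_exponent_le hc (by linarith)
    have h2 : 1 * c ^ (2 / 3 - 2 * d) ≤ 2 * Real.pi * n₀ * c ^ (2 / 3 - 2 * d) := by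
      gcongr
      nlinarith
    linarith) (by
    have : w₀ ^ 2 / (8 * n₀ ^ 2 * L ^ 2) = c / L ^ 2 / (8 * n₀ ^ 3) := by
      rw [hw2]
      field_simp
    rw [this, hcL, le_div_iff₀ (by positivity)]
    exact hR)
  have e1 : ‖a n₀‖ / 2 * √(w₀ / (4 * n₀)) = k * c ^ (1 / 4 : ℝ) := by
    have : w₀ / (4 * n₀) = √c * (1 / (4 * n₀ * √n₀)) := by
      rw [hw₀, Real.sqrt_div hc0.le]
      field_simp
    rw [this, Real.sqrt_mul (Real.sqrt_nonneg _), hk, Real.sqrt_eq_rpow (√c), Real.sqrt_eq_rpow c,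
      ← Real.rpow_mul hc0.le]
    norm_num
    ring
  have e2 : C₁ * (w₀ * Real.exp (-(1 / (8 * n₀) * c ^ d)) * (n₀ * w₀ ^ 2) ^ B) ≤ 1 := by
    rw [hcw]
    have hwc' : w₀ ≤ c := by
      refine hwc.trans ?_
      nth_rewrite 2 [← Real.rpow_one c]
      exact Real.rpow_le_rpow_of_exponent_le hc (by norm_num)
    have h1 : c ^ ((B : ℝ) + 1) = c * c ^ B := by
      rw [Real.rpow_add_one hc0.ne', Real.rpow_natCast, mul_comm]
    rw [h1, le_div_iff₀ hC₁] at htail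
    refine le_trans ?_ htail
    calc _ ≤ C₁ * (c * Real.exp (-(1 / (8 * n₀) * c ^ d)) * c ^ B) := by gcongr
      _ = _ := by ring
  have e3 : C₂ * (Real.exp (-(w₀ ^ 2 / (16 * L ^ 2))) * L) ≤ 1 := by
    have : w₀ ^ 2 / (16 * L ^ 2) = 1 / (16 * n₀) * (c / L ^ 2) := by
      rw [hw2]
      field_simp
    rw [this, hcL]
    rw [le_div_iff₀ hC₂] at htail'
    linarith
  have e4 : (n₀ * w₀ ^ 2) ^ ν * (2 / w₀) ^ (2 * j + 1) * L =
      (2 * √n₀) ^ (2 * j + 1) * c ^ (ν - j - 1 / 2 + (1 / 3 - d)) := by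
    have h1 : 2 / w₀ = 2 * √n₀ * c ^ (-(1 / 2) : ℝ) := by
      rw [Real.rpow_neg hc0.le, ← Real.sqrt_eq_rpow, hw₀, Real.sqrt_div hc0.le]
      field_simp
    rw [hcw, h1, mul_pow, ← Real.rpow_mul_natCast hc0.le, hLdef]
    have h2 : c ^ (ν - j - 1 / 2 + (1 / 3 - d)) =
        c ^ ν * c ^ (-(1 / 2) * ((2 * j + 1 : ℕ) : ℝ)) * c ^ (1 / 3 - d) := by
      rw [← Real.rpow_add hc0, ← Real.rpow_add hc0]
      congr 1
      push_cast
      ring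
    rw [h2]
    ring
  rw [e4, hcw] at hwin'
  rw [hcw] at e2
  rw [e1] at hmain'
  set S := ∑ n ∈ nearIndices c H, ‖Spart a ν n‖ with hS
  have hS0 : 0 ≤ S := Finset.sum_nonneg fun _ _ => norm_nonneg _
  have htri := norm_sub_norm_le (∫ u : ℝ, stationaryPhase n₀ w₀ L 0 (u + I) * f (u + I))
    (∫ u in w₀ / 2..3 * w₀ / 2, stationaryPhase n₀ w₀ L 0 (u + I) * f (u + I))
  have e5 : k * c ^ (1 / 4 : ℝ) ≤ C₃ * (c ^ (ν - j - 1 / 2 + (1 / 3 - d)) * S) + 2 := by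
    rw [hC₃]
    linarith
  have e6 : 0 ≤ c ^ (ν - j - 1 / 2 + (1 / 3 - d)) * S := by positivity
  rw [div_mul_eq_mul_div, ← add_div, le_div_iff₀ hk0]
  linarith
end IsInversionSeries

lemma Spart_im_eq_zero {a : ℕ → ℂ} (ha : ∀ n, (a n).im = 0) (ν : ℝ) (n : ℕ) :
    (Spart a ν n).im = 0 := by
  rw [Spart, im_sum]
  exact Finset.sum_eq_zero fun m _ => by rw [im_mul_ofReal, ha, zero_mul]

lemma gaussian_le_of_far {c H h : ℝ} (hh : 0 < h) (hhc : h ≤ c) (hH : 0 ≤ H) {n : ℝ}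
    (hn : H ≤ |n - c|) :
    Real.exp (-(Real.pi * ((n - c) / h) ^ 2)) ≤
      Real.exp (-((H / h) ^ 2)) * Real.exp 2 * Real.exp (-(n / c)) := by
  have hc : 0 < c := by linarith
  have hpi := Real.pi_gt_three
  rw [← Real.exp_add, ← Real.exp_add]
  apply Real.exp_le_exp.mpr
  have h1 : (H / h) ^ 2 ≤ ((n - c) / h) ^ 2 := by
    rw [div_pow, div_pow, ← sq_abs (n - c)]
    gcongr
  have h2 : (n / c - 1) ^ 2 ≤ ((n - c) / h) ^ 2 := by
    have : n / c - 1 = (n - c) / c := by field_simp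
    rw [this, div_pow, div_pow]
    gcongr
  nlinarith [sq_nonneg (n / c - 3 / 2), sq_nonneg ((n - c) / h)]

namespace IsInversionSeries

variable {j : ℕ} {f : ℂ → ℂ} {a : ℕ → ℂ}

lemma eventually_exists_pos_near (h : IsInversionSeries j f a) (hreal : ∀ n, (a n).im = 0)
    {n₀ : ℕ} (han : a n₀ ≠ 0) {ν : ℝ} (hν : 0 ≤ ν) (hνj : ν < j - 1 / 2 + 1 / 6) {d : ℝ}
    (hd : 0 < d) (hd' : d ≤ 1 / 48) :
    ∀ᶠ c : ℝ in atTop, ∃ n : ℕ, |(n : ℝ) - c| ≤ c ^ (2 / 3 + 3 * d) ∧ 0 < (Spart a ν n).re := by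
  have hn₀ : 1 ≤ n₀ := by
    rcases Nat.eq_zero_or_pos n₀ with rfl | hn
    · exact absurd h.coeff_zero han
    · exact hn
  obtain ⟨C₁, hC₁, hlower⟩ := h.exists_rpow_quarter_le hn₀ han hν hd hd'
  obtain ⟨C₂, hC₂, hgauss⟩ := h.exists_norm_gaussian_sum_le hν
    (by linarith : 1 / 2 < 2 / 3 + 2 * d) (by linarith) hd (by linarith)
  obtain ⟨A, C₀, ha⟩ := h.coeff_bound
  have hC₀ : 0 ≤ C₀ := by simpa using (norm_nonneg _).trans (ha 1)
  obtain ⟨C₃, hC₃, hsum⟩ := exists_tsum_succ_pow_mul_exp_neg_div_le (A + 1)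
  set K := C₁ * (Real.exp Real.pi * (C₂ + 2)) + C₁ with hK
  filter_upwards [hlower, hgauss, eventually_ge_atTop 1,
    eventually_rpow_mul_exp_neg_rpow_le (A + 2) one_pos (by linarith : 0 < 2 * d)
      (by positivity : 0 < 1 / ((C₀ + 1) * Real.exp 2 * C₃)),
    eventually_const_mul_rpow_le_rpow (K + 1) (by norm_num : (5 / 24 : ℝ) < 1 / 4)]
    with c hlow hg hc htail hK'
  by_contra! hneg
  obtain ⟨hs, hG⟩ := hg
  have hc0 : 0 < c := by linarith
  set θ : ℝ := 2 / 3 + 2 * d with hθ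
  set H := c ^ θ with hH
  have hH0 : 0 < H := by positivity
  have hHc : H ≤ c := by
    calc H ≤ c ^ (1 : ℝ) := Real.rpow_le_rpow_of_exponent_le hc (by rw [hθ]; linarith)
      _ = c := Real.rpow_one c
  have hratio : (c ^ (2 / 3 + 3 * d) / H) ^ 2 = c ^ (2 * d) := by
    rw [hH, ← Real.rpow_sub hc0, ← Real.rpow_mul_natCast hc0.le]
    congr 1
    rw [hθ]
    push_cast
    ring
  set g : ℕ → ℝ := fun n => Real.exp (-(Real.pi * ((n - c) / H) ^ 2)) with hgdef
  obtain ⟨hus, hule⟩ := hsum c hc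
  set q : ℝ := C₀ * Real.exp (-(c ^ (2 * d))) * Real.exp 2 with hq
  have hq0 : 0 ≤ q := by positivity
  have hpoint : ∀ n : ℕ, ‖Spart a ν n * (g n : ℂ)‖ ≤ -(Spart a ν n * (g n : ℂ)).re +
      2 * q * (((n : ℝ) + 1) ^ (A + 1) * Real.exp (-(n / c))) := by
    intro n
    have hg0 : 0 ≤ g n := (Real.exp_pos _).le
    by_cases hn : |(n : ℝ) - c| ≤ c ^ (2 / 3 + 3 * d)
    · have h1 := hneg n hn
      have h2 : ‖Spart a ν n‖ = -(Spart a ν n).re := by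
        have : Spart a ν n = ((Spart a ν n).re : ℂ) := by
          apply Complex.ext <;> simp [Spart_im_eq_zero hreal]
        rw [this, norm_real, Real.norm_of_nonpos h1, ofReal_re]
      have h3 : 0 ≤ 2 * q * (((n : ℝ) + 1) ^ (A + 1) * Real.exp (-(n / c))) := by positivity
      rw [norm_mul, h2, norm_real, Real.norm_of_nonneg hg0, re_mul_ofReal]
      linarith
    · have h1 : ‖Spart a ν n * (g n : ℂ)‖ ≤
          q * (((n : ℝ) + 1) ^ (A + 1) * Real.exp (-(n / c))) := by
        rw [norm_mul, norm_real, Real.norm_of_nonneg hg0]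
        have h2 := exists_norm_Spart_le h.coeff_zero ha hν n
        have h3 := gaussian_le_of_far hH0 hHc (by positivity) (not_le.mp hn).le
        rw [hratio] at h3
        calc _ ≤ (C₀ * ((n : ℝ) + 1) ^ (A + 1)) *
              (Real.exp (-(c ^ (2 * d))) * Real.exp 2 * Real.exp (-(n / c))) := by
              gcongr
              refine h2.trans ?_
              gcongr
              linarith
          _ = _ := by rw [hq]; ring
      have h2 := (neg_le_abs _).trans (abs_re_le_norm (Spart a ν n * (g n : ℂ)))
      have h3 := neg_le_neg ((le_abs_self _).trans (abs_re_le_norm (Spart a ν n * (g n : ℂ))))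
      linarith
  have hre : HasSum (fun n : ℕ => (Spart a ν n * (g n : ℂ)).re)
      (∑' n : ℕ, Spart a ν n * (g n : ℂ)).re := hasSum_re hs.hasSum
  have htotal := hasSum_le hpoint hs.norm.hasSum (hre.neg.add (hus.hasSum.mul_left (2 * q)))
  have hqsmall : 2 * q * ∑' n : ℕ, ((n : ℝ) + 1) ^ (A + 1) * Real.exp (-(n / c)) ≤ 2 := by
    have h1 : c ^ ((A : ℝ) + 2) = c ^ (A + 1 + 1) := by
      rw [← Real.rpow_natCast]
      congr 1
      push_cast
      ring
    rw [h1, one_mul, le_div_iff₀ (by positivity)] at htail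
    have h2 : q ≤ (C₀ + 1) * Real.exp (-(c ^ (2 * d))) * Real.exp 2 := by
      rw [hq]
      gcongr
      linarith
    calc _ ≤ 2 * ((C₀ + 1) * Real.exp (-(c ^ (2 * d))) * Real.exp 2) * (C₃ * c ^ (A + 1 + 1)) := by
          gcongr
      _ = 2 * (c ^ (A + 1 + 1) * Real.exp (-(c ^ (2 * d))) * ((C₀ + 1) * Real.exp 2 * C₃)) := by
          ring
      _ ≤ 2 := by linarith
  have hnear : ∑ n ∈ nearIndices c H, ‖Spart a ν n‖ ≤
      Real.exp Real.pi * ∑' n : ℕ, ‖Spart a ν n * (g n : ℂ)‖ := by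
    refine le_trans ?_ (mul_le_mul_of_nonneg_left
      (hs.norm.sum_le_tsum (nearIndices c H) fun _ _ => norm_nonneg _) (Real.exp_pos _).le)
    rw [Finset.mul_sum]
    refine Finset.sum_le_sum fun n hn => ?_
    rw [mem_nearIndices hHc] at hn
    rw [norm_mul, norm_real, Real.norm_of_nonneg (Real.exp_pos _).le]
    have h1 : 1 ≤ Real.exp Real.pi * g n := by
      rw [hgdef, ← Real.exp_add]
      apply Real.one_le_exp
      have : ((n - c) / H) ^ 2 ≤ 1 := by
        rw [sq_le_one_iff_abs_le_one, abs_div, abs_of_pos hH0, div_le_one hH0]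
        exact hn
      nlinarith [Real.pi_pos]
    nlinarith [norm_nonneg (Spart a ν n)]
  have hre' := (neg_le_abs _).trans (abs_re_le_norm (∑' n : ℕ, Spart a ν n * (g n : ℂ)))
  have hone : 1 ≤ c ^ (θ + d) := Real.one_le_rpow hc (by rw [hθ]; linarith)
  have hbound : ∑ n ∈ nearIndices c H, ‖Spart a ν n‖ ≤
      Real.exp Real.pi * ((C₂ + 2) * c ^ (θ + d)) := by
    refine hnear.trans ?_
    gcongr
    linarith
  have hfinal : c ^ (1 / 4 : ℝ) ≤ K * c ^ (5 / 24 : ℝ) := by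
    refine hlow.trans ?_
    have h1 : c ^ (ν - j - 1 / 2 + (1 / 3 - d)) * c ^ (θ + d) ≤ c ^ (5 / 24 : ℝ) := by
      rw [← Real.rpow_add hc0]
      apply Real.rpow_le_rpow_of_exponent_le hc
      rw [hθ]
      linarith
    have h2 : 1 ≤ c ^ (5 / 24 : ℝ) := Real.one_le_rpow hc (by norm_num)
    calc _ ≤ C₁ * (c ^ (ν - j - 1 / 2 + (1 / 3 - d)) *
          (Real.exp Real.pi * ((C₂ + 2) * c ^ (θ + d)))) + C₁ := by gcongr
      _ = C₁ * (Real.exp Real.pi * (C₂ + 2)) *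
          (c ^ (ν - j - 1 / 2 + (1 / 3 - d)) * c ^ (θ + d)) + C₁ * 1 := by ring
      _ ≤ C₁ * (Real.exp Real.pi * (C₂ + 2)) * c ^ (5 / 24 : ℝ) + C₁ * c ^ (5 / 24 : ℝ) := by
          gcongr
      _ = _ := by rw [hK]; ring
  have : 0 < c ^ (5 / 24 : ℝ) := by positivity
  linarith

lemma eventually_exists_pos (h : IsInversionSeries j f a) (hreal : ∀ n, (a n).im = 0)
    {n₀ : ℕ} (han : a n₀ ≠ 0) {ν : ℝ} (hν : 0 ≤ ν) (hνj : ν < j - 1 / 2 + 1 / 6) {ε r : ℝ}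
    (hε : 0 < ε) (hr : 2 / 3 + ε ≤ r) :
    ∀ᶠ X : ℝ in atTop, ∃ n : ℕ, X < n ∧ n ≤ X + X ^ r ∧ 0 < (Spart a ν n).re := by
  set d : ℝ := min (1 / 48) (ε / 4) with hd
  have hd0 : 0 < d := by positivity
  have hd1 : d ≤ 1 / 48 := min_le_left _ _
  have hd2 : d ≤ ε / 4 := min_le_right _ _
  have htend : Tendsto (fun X : ℝ => X + X ^ (2 / 3 + 4 * d) / 2) atTop atTop := by
    refine tendsto_atTop_mono' _ ?_ tendsto_id
    filter_upwards [eventually_ge_atTop 0] with X hX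
    have : 0 ≤ X ^ (2 / 3 + 4 * d) / 2 := by positivity
    simp only [id]
    linarith
  filter_upwards [htend.eventually (h.eventually_exists_pos_near hreal han hν hνj hd0 hd1),
    eventually_ge_atTop 1,
    eventually_const_mul_rpow_le_rpow 5 (by linarith : 2 / 3 + 3 * d < 2 / 3 + 4 * d)]
    with X ⟨n, hn, hpos⟩ hX hlarge
  have hX0 : 0 < X := by linarith
  set D := X ^ (2 / 3 + 4 * d) with hD
  have hD0 : 0 < D := by positivity
  have hDX : D ≤ X := by
    calc D ≤ X ^ (1 : ℝ) := Real.rpow_le_rpow_of_exponent_le hX (by linarith)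
      _ = X := Real.rpow_one X
  have hDr : D ≤ X ^ r := Real.rpow_le_rpow_of_exponent_le hX (by linarith)
  have hsmall : (X + D / 2) ^ (2 / 3 + 3 * d) < D / 2 := by
    have h1 : (X + D / 2) ^ (2 / 3 + 3 * d) ≤ 2 * X ^ (2 / 3 + 3 * d) := by
      calc _ ≤ (2 * X) ^ (2 / 3 + 3 * d) := by
            gcongr
            linarith
        _ = 2 ^ (2 / 3 + 3 * d) * X ^ (2 / 3 + 3 * d) := Real.mul_rpow (by norm_num) hX0.le
        _ ≤ 2 ^ (1 : ℝ) * X ^ (2 / 3 + 3 * d) := by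
            gcongr
            · norm_num
            · linarith
        _ = _ := by rw [Real.rpow_one]
    have h2 : 0 < X ^ (2 / 3 + 3 * d) := by positivity
    linarith
  have hn' := abs_le.mp hn
  exact ⟨n, by linarith [hn'.1], by linarith [hn'.2], hpos⟩

lemma const_mul (c : ℂ) (h : IsInversionSeries j f a) :
    IsInversionSeries j (fun z => c * f z) (fun n => c * a n) where
  coeff_zero := by simp [h.coeff_zero]
  coeff_bound := by
    obtain ⟨A, C, hC⟩ := h.coeff_bound
    refine ⟨A, ‖c‖ * C, fun n => ?_⟩
    rw [norm_mul, mul_assoc]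
    gcongr
    exact hC n
  hasSum z hz := by simpa only [mul_assoc] using (h.hasSum z hz).mul_left c
  inversion z hz := by rw [h.inversion z hz]; ring

lemma ofReal_re (h : IsInversionSeries j f a) :
    IsInversionSeries j (fun z => (f z + (starRingEnd ℂ) (f (-(starRingEnd ℂ) z))) / 2)
      (fun n => ((a n).re : ℂ)) where
  coeff_zero := by simp [h.coeff_zero]
  coeff_bound := by
    obtain ⟨A, C, hC⟩ := h.coeff_bound
    refine ⟨A, C, fun n => le_trans ?_ (hC n)⟩
    rw [norm_real]
    exact abs_re_le_norm _
  hasSum z hz := by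
    have hz' : 0 < (-(starRingEnd ℂ) z).im := by simpa using hz
    have hs := ((h.hasSum z hz).add (hasSum_conj'.mpr (h.hasSum _ hz'))).div_const 2
    refine hs.congr_fun fun n => ?_
    have : (starRingEnd ℂ) (fourierExp (n * -(starRingEnd ℂ) z)) = fourierExp (n * z) := by
      rw [fourierExp, fourierExp, ← exp_conj]
      congr 1
      simp [conj_ofNat]
    rw [map_mul, this, re_eq_add_conj]
    ring
  inversion z hz := by
    have hz' : 0 < (-(starRingEnd ℂ) z).im := by simpa using hz
    have : -(starRingEnd ℂ) (-1 / z) = -1 / -(starRingEnd ℂ) z := by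
      simp [div_neg, neg_div]
    rw [this, h.inversion z hz, h.inversion _ hz', map_mul, map_pow, map_neg, conj_conj,
      Even.neg_pow (even_two_mul j)]
    ring

lemma eventually_exists_pos_and_neg (h : IsInversionSeries j f a) {n₀ : ℕ}
    (han : (a n₀).re ≠ 0) {ν : ℝ} (hν : 0 ≤ ν) (hνj : ν < j - 1 / 2 + 1 / 6) {ε r : ℝ}
    (hε : 0 < ε) (hr : 2 / 3 + ε ≤ r) :
    ∀ᶠ X : ℝ in atTop,
      (∃ n : ℕ, X < n ∧ n ≤ X + X ^ r ∧ 0 < (Spart a ν n).re) ∧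
      (∃ n : ℕ, X < n ∧ n ≤ X + X ^ r ∧ (Spart a ν n).re < 0) := by
  have hSpart : ∀ n, (Spart (fun m => ((a m).re : ℂ)) ν n).re = (Spart a ν n).re := by
    simp [Spart]
  have hSpart' : ∀ n, (Spart (fun m => -1 * ((a m).re : ℂ)) ν n).re = -(Spart a ν n).re := by
    simp [Spart]
  have hpos := h.ofReal_re.eventually_exists_pos (fun n => ofReal_im _) (n₀ := n₀)
    (ofReal_ne_zero.mpr han) hν hνj hε hr
  have hneg := (h.ofReal_re.const_mul (-1)).eventually_exists_pos (n₀ := n₀) (by simp)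
    (by simpa using han) hν hνj hε hr
  simp only [hSpart] at hpos
  simp only [hSpart', neg_pos] at hneg
  exact hpos.and hneg

end IsInversionSeries

namespace IsCuspFormSL2

open scoped MatrixGroups ModularForm Manifold
open UpperHalfPlane hiding I

variable {k : ℤ} {f : ℂ → ℂ} {a : ℕ → ℂ}

lemma hasSum_fourierExp (h : IsCuspFormSL2 k f a) {z : ℂ} (hz : 0 < z.im) :
    HasSum (fun n : ℕ => Function.update a 0 0 n * fourierExp (n * z)) (f z) := by
  rw [← hasSum_nat_add_iff' 1, Finset.sum_range_one, Function.update_self, zero_mul, sub_zero]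
  refine (h.2.2 z hz).congr_fun fun n => ?_
  rw [Function.update_of_ne (Nat.succ_ne_zero n), fourierExp]
  congr 2
  push_cast
  ring

lemma comp_coe_slash (h : IsCuspFormSL2 k f a) (γ : SL(2, ℤ)) :
    (fun τ : ℍ => f τ) ∣[k] γ = fun τ : ℍ => f τ := by
  ext τ
  rw [ModularForm.slash_action_eq'_iff, coe_specialLinearGroup_apply]
  simpa [mEntry] using h.2.1 γ τ τ.im_pos

lemma hasSum_qParam (h : IsCuspFormSL2 k f a) (τ : ℍ) :
    HasSum (fun n : ℕ => Function.update a 0 0 n • Function.Periodic.qParam 1 τ ^ n) (f τ) := by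
  refine (h.hasSum_fourierExp τ.im_pos).congr_fun fun n => ?_
  rw [fourierExp_natCast_mul, fourierExp, Function.Periodic.qParam]
  simp

/-- The modular form of level one underlying a cusp form given by its values on the half-plane. -/
noncomputable def toModularForm (h : IsCuspFormSL2 k f a) : ModularForm 𝒮ℒ k where
  toFun τ := f τ
  slash_action_eq' := fun _ ⟨γ, hγ⟩ => hγ ▸ h.comp_coe_slash γ
  holo' := by
    rw [UpperHalfPlane.mdifferentiable_iff]
    refine h.1.congr fun z hz => ?_
    simp [ofComplex_apply_of_im_pos hz]
  bdd_at_cusps' {c} hc := by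
    rw [Subgroup.IsArithmetic.isCusp_iff_isCusp_SL2Z] at hc
    rw [OnePoint.isBoundedAt_iff_forall_SL2Z hc]
    intro γ _
    rw [h.comp_coe_slash γ]
    exact isBoundedAtImInfty_of_hasSum_qExpansion one_pos h.hasSum_qParam

lemma exists_norm_coeff_le {K : ℕ} (h : IsCuspFormSL2 K f a) :
    ∃ C : ℝ, ∀ n, ‖Function.update a 0 0 n‖ ≤ C * (n : ℝ) ^ K := by
  have hO := ModularFormClass.qExpansion_isBigO (Int.natCast_nonneg K) h.toModularForm
  have hcoeff := ModularFormClass.qExpansion_coeff_unique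
    (Γ := 𝒮ℒ) (f := h.toModularForm) one_pos
    (Subgroup.strictWidthInfty_SL2Z ▸ Subgroup.strictWidthInfty_mem_strictPeriods _) h.hasSum_qParam
  rw [Subgroup.strictWidthInfty_SL2Z] at hO
  simp only [← hcoeff] at hO
  obtain ⟨C, -, hC⟩ := bound_of_isBigO_nat_atTop hO
  refine ⟨C, fun n => ?_⟩
  rcases eq_or_ne n 0 with rfl | hn
  · have hC1 := hC (x := 1) (by simp)
    simp only [Nat.cast_one, one_zpow, norm_one, mul_one] at hC1
    have : 0 ≤ C := (norm_nonneg _).trans hC1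
    rw [Function.update_self, norm_zero]
    positivity
  · have hn' : (n : ℝ) ^ (K : ℤ) ≠ 0 := by positivity
    simpa using hC hn'

lemma isInversionSeries {j : ℕ} (h : IsCuspFormSL2 (2 * j : ℕ) f a) :
    IsInversionSeries j f (Function.update a 0 0) where
  coeff_zero := Function.update_self ..
  coeff_bound := ⟨2 * j, h.exists_norm_coeff_le⟩
  hasSum z hz := h.hasSum_fourierExp hz
  inversion z hz := by
    have := h.2.1 ModularGroup.S z hz
    rw [zpow_natCast] at this
    simpa [mEntry, ModularGroup.S] using this

end IsCuspFormSL2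

lemma Spart_update_zero (a : ℕ → ℂ) (c : ℂ) (ν : ℝ) (n : ℕ) :
    Spart (Function.update a 0 c) ν n = Spart a ν n := by
  refine Finset.sum_congr rfl fun m hm => ?_
  rw [Function.update_of_ne (by have := (Finset.mem_Icc.mp hm).1; omega)]

/-- Sign changes of the real (resp. imaginary) parts of the partial sums
`S_f^ν(n)` of a cusp form of even weight `k` for `SL(2, ℤ)` in every interval
`(X, X + X^{r(ν)}]` for `X` large, where `κ = (k−1)/2`, `0 ≤ ν < κ + 1/6`, and
`r(ν) = 2/3 + ε` if `ν < κ − 1/6`, while `r(ν) = 2/3 + Δ + ε` if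
`ν = κ − 1/6 + Δ` with `0 ≤ Δ < 1/3`. -/
theorem stmt_16 (k : ℤ) (hk : Even k) (f : ℂ → ℂ) (a : ℕ → ℂ)
    (hf : IsCuspFormSL2 k f a)
    (ν : ℝ) (hν0 : 0 ≤ ν) (hν1 : ν < ((k : ℝ) - 1) / 2 + 1 / 6)
    (ε : ℝ) (hε : 0 < ε) (r : ℝ)
    (hr : r = if ν < ((k : ℝ) - 1) / 2 - 1 / 6 then 2 / 3 + ε
      else 2 / 3 + (ν - (((k : ℝ) - 1) / 2 - 1 / 6)) + ε) :
    ((∃ n : ℕ, 1 ≤ n ∧ (a n).re ≠ 0) →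
      ∃ X₀ : ℝ, 0 < X₀ ∧ ∀ X : ℝ, X₀ ≤ X →
        (∃ n : ℕ, (X : ℝ) < n ∧ (n : ℝ) ≤ X + X ^ r ∧ 0 < (Spart a ν n).re) ∧
        (∃ m : ℕ, (X : ℝ) < m ∧ (m : ℝ) ≤ X + X ^ r ∧ (Spart a ν m).re < 0)) ∧
    ((∃ n : ℕ, 1 ≤ n ∧ (a n).im ≠ 0) →
      ∃ X₀ : ℝ, 0 < X₀ ∧ ∀ X : ℝ, X₀ ≤ X →
        (∃ n : ℕ, (X : ℝ) < n ∧ (n : ℝ) ≤ X + X ^ r ∧ 0 < (Spart a ν n).im) ∧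
        (∃ m : ℕ, (X : ℝ) < m ∧ (m : ℝ) ≤ X + X ^ r ∧ (Spart a ν m).im < 0)) := by
  have hk0 : 0 ≤ k := by
    have : (0 : ℝ) < k := by linarith
    exact_mod_cast this.le
  obtain ⟨j, rfl⟩ : ∃ j : ℕ, k = (2 * j : ℕ) := by
    obtain ⟨i, rfl⟩ := hk
    exact ⟨i.toNat, by omega⟩
  have hνj : ν < j - 1 / 2 + 1 / 6 := by
    push_cast at hν1
    linarith
  have hrε : 2 / 3 + ε ≤ r := by
    rw [hr]
    split_ifs <;> linarith
  have h := hf.isInversionSeries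
  constructor
  · rintro ⟨n₀, hn₀, han⟩
    have hev := h.eventually_exists_pos_and_neg (n₀ := n₀)
      (by rwa [Function.update_of_ne (by omega)]) hν0 hνj hε hrε
    simp only [Spart_update_zero] at hev
    obtain ⟨X₀, hX₀, hX⟩ := (atTop_basis' (1 : ℝ)).eventually_iff.mp hev
    exact ⟨X₀, by linarith, fun X hXX₀ => hX hXX₀⟩
  · rintro ⟨n₀, hn₀, han⟩
    have hSpart : ∀ n, (Spart (fun m => -I * Function.update a 0 0 m) ν n).re
        = (Spart a ν n).im := by
      intro n
      rw [← Spart_update_zero a 0 ν n]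
      simp [Spart]
    have hev := (h.const_mul (-I)).eventually_exists_pos_and_neg (n₀ := n₀)
      (by rw [Function.update_of_ne (by omega)]; simpa using han) hν0 hνj hε hrε
    simp only [hSpart] at hev
    obtain ⟨X₀, hX₀, hX⟩ := (atTop_basis' (1 : ℝ)).eventually_iff.mp hev
    exact ⟨X₀, by linarith, fun X hXX₀ => hX hXX₀⟩
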